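/- Let n ≥ 1 and let G_n = G_n(m₁, …, m_n) be the caterpillar graph consisting of a central path on n vertices with m_i ≥ 1 pendant edges (legs) attached to the i-th vertex of the path. Put t_i = m_i − 1. If n = 2k, then M(G_n) is homotopy equivalent to the wedge, over ℓ = 0, 1, …, k, of M_{2ℓ}^{2k}(t₁, …, t_{2k}) copies of the sphere S^{k−1+ℓ}. If n = 2k+1, then M(G_n) is homotopy equivalent to the wedge, over ℓ = 0, 1, …, k, of M_{2ℓ+1}^{2k+1}(t₁, …, t_{2k+1}) copies of the sphere S^{k+ℓ}. -/

import Mathlib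

open SimpleGraph

/-- Two edges (as elements of `Sym2 V`) are incident if they share a vertex. -/
def EdgeIncident {V : Type*} (e f : Sym2 V) : Prop := ∃ v, v ∈ e ∧ v ∈ f

/-- The matching complex of a graph, as the set of its faces:
finite sets of pairwise non-incident edges of `G`. -/
def matchingComplex {V : Type*} (G : SimpleGraph V) : Set (Finset (Sym2 V)) :=
  {m | (∀ e ∈ m, e ∈ G.edgeSet) ∧
    (m : Set (Sym2 V)).Pairwise fun e f => ¬ EdgeIncident e f}

/-- The geometric realization of an abstract simplicial complex, given as a
downward-closed set of finite subsets of the vertex type `α`. -/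
abbrev Realization {α : Type*} (K : Set (Finset α)) : Type _ :=
  { f : α → ℝ // (∀ a, 0 ≤ f a) ∧
      ∃ s ∈ K, (∀ a, f a ≠ 0 → a ∈ s) ∧ ∑ a ∈ s, f a = 1 }

/-- The `n`-dimensional sphere. -/
abbrev SphereD (n : ℕ) : Type :=
  Metric.sphere (0 : EuclideanSpace ℝ (Fin (n + 1))) 1

/-- A basepoint of the `n`-sphere. -/
noncomputable def SphereD.pt (n : ℕ) : SphereD n :=
  ⟨EuclideanSpace.single 0 1, by simp [EuclideanSpace.norm_single]⟩

/-- The relation collapsing all basepoints (and the extra point) of a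
family of pointed spaces to one point. -/
def WedgeRel {ι : Type*} (X : ι → Type*) (pt : ∀ i, X i) :
    ((Σ i, X i) ⊕ Unit) → ((Σ i, X i) ⊕ Unit) → Prop := fun p q =>
  (p = Sum.inr () ∨ ∃ i, p = Sum.inl ⟨i, pt i⟩) ∧
  (q = Sum.inr () ∨ ∃ i, q = Sum.inl ⟨i, pt i⟩)

/-- The wedge sum of a family of pointed spaces (with an extra basepoint, so that
the wedge of the empty family is a one-point space). -/
abbrev PWedge {ι : Type*} (X : ι → Type*) [∀ i, TopologicalSpace (X i)]
    (pt : ∀ i, X i) : Type _ :=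
  Quot (WedgeRel X pt)

/-- A wedge of spheres with prescribed dimensions `d i`. -/
noncomputable abbrev WedgeOfSpheres {ι : Type*} (d : ι → ℕ) : Type _ :=
  PWedge (fun i => SphereD (d i)) (fun i => SphereD.pt (d i))

/-- The caterpillar graph on a central path with `n` vertices, with `m i` pendant
edges (legs) attached to the `i`-th path vertex. -/
def caterpillar (n : ℕ) (m : Fin n → ℕ) :
    SimpleGraph (Fin n ⊕ Σ i : Fin n, Fin (m i)) :=
  SimpleGraph.fromRel fun p q =>
    match p, q with
    | Sum.inl i, Sum.inl j => (i : ℕ) + 1 = (j : ℕ)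
    | Sum.inl i, Sum.inr j => i = j.1
    | _, _ => False

/-- A finite set of naturals can be covered by disjoint 2-blocks: it is a disjoint
union of blocks `{j, j+1}` of two consecutive positions. -/
def Pairable (S : Finset ℕ) : Prop :=
  ∃ P : Finset ℕ, (∀ j ∈ P, ∀ l ∈ P, j ≠ l → j + 2 ≤ l ∨ l + 2 ≤ j) ∧
    S = P.biUnion fun j => {j, j + 1}

open scoped Classical in
/-- `A_x^n`: the `x`-element subsets of `[n] = {1, …, n}` whose complement in `[n]`
can be partitioned into `(n−x)/2` disjoint 2-blocks. -/
noncomputable def markedSets (n x : ℕ) : Finset (Finset ℕ) :=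
  (Finset.Icc 1 n).powerset.filter fun s =>
    s.card = x ∧ Pairable (Finset.Icc 1 n \ s)

/-- `M_x^n(t₁, …, t_n) = Σ_{(i₁,…,i_x) ∈ A_x^n} t_{i₁} ⋯ t_{i_x}`. -/
noncomputable def Msum {R : Type*} [CommSemiring R] (n x : ℕ) (t : ℕ → R) : R :=
  ∑ s ∈ markedSets n x, ∏ i ∈ s, t i

section WedgeQuotient

variable {ι : Type*} {X : Type*} [TopologicalSpace X] [CompactSpace X]
  {Y : ι → Type*} [∀ i, TopologicalSpace (Y i)]

open Classical in
/-- The canonical map from the wedge sum to the product. -/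
noncomputable def wedgeToPi (pt : ∀ i, Y i) : PWedge Y pt → ∀ i, Y i :=
  Quot.lift (Sum.elim (fun p => Function.update pt p.1 p.2) fun _ => pt) <| by
    have key : ∀ p : (Σ i, Y i) ⊕ Unit, (p = Sum.inr () ∨ ∃ i, p = Sum.inl ⟨i, pt i⟩) →
        Sum.elim (fun p : Σ i, Y i => Function.update pt p.1 p.2) (fun _ => pt) p = pt := by
      rintro p (rfl | ⟨i, rfl⟩) <;> simp
    rintro p q ⟨hp, hq⟩
    rw [key p hp, key q hq]

theorem continuous_wedgeToPi (pt : ∀ i, Y i) : Continuous (wedgeToPi pt) := by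
  classical
  refine continuous_quot_lift _ (Continuous.sumElim ?_ continuous_const)
  refine continuous_sigma fun i => ?_
  exact continuous_const.update i continuous_id

theorem wedgeToPi_injective (pt : ∀ i, Y i) : Function.Injective (wedgeToPi pt) := by
  classical
  rintro ⟨p⟩ ⟨q⟩ h
  change Sum.elim (fun p : Σ i, Y i => Function.update pt p.1 p.2) (fun _ => pt) p =
    Sum.elim (fun p : Σ i, Y i => Function.update pt p.1 p.2) (fun _ => pt) q at h
  rcases p with ⟨i, y⟩ | _ <;> rcases q with ⟨j, z⟩ | _
  · by_cases hij : i = j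
    · subst hij
      have := congrFun h i
      simp only [Sum.elim_inl, Function.update_self] at this
      rw [this]
    · have h1 := congrFun h i
      have h2 := congrFun h j
      simp only [Sum.elim_inl, Function.update_self, Function.update_of_ne hij,
        Function.update_of_ne (Ne.symm hij)] at h1 h2
      subst h1 h2
      exact Quot.sound ⟨Or.inr ⟨_, rfl⟩, Or.inr ⟨_, rfl⟩⟩
  · have h1 := congrFun h i
    simp only [Sum.elim_inl, Sum.elim_inr, Function.update_self] at h1
    subst h1
    exact Quot.sound ⟨Or.inr ⟨_, rfl⟩, Or.inl rfl⟩
  · have h1 := congrFun h j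
    simp only [Sum.elim_inl, Sum.elim_inr, Function.update_self] at h1
    subst h1
    exact Quot.sound ⟨Or.inl rfl, Or.inr ⟨_, rfl⟩⟩
  · rfl

/-- A compact space is homotopy equivalent to a wedge obtained by collapsing a subspace `A`, as soon
as the identity is homotopic, through maps preserving `A`, to a map that is constant on `A`. -/
theorem nonempty_homotopyEquiv_pwedge [Finite ι] [∀ i, CompactSpace (Y i)] [∀ i, T2Space (Y i)]
    (pt : ∀ i, Y i) (c : ∀ i, X → Y i) (hc : ∀ i, Continuous (c i))
    (hsurj : ∀ i, Function.Surjective (c i))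
    (hinj : ∀ i x y, c i x = c i y → c i x ≠ pt i → x = y)
    (hdisj : ∀ i j x, c i x ≠ pt i → c j x ≠ pt j → i = j)
    (Φ : C(unitInterval × X, X)) (h0 : ∀ x, Φ (0, x) = x)
    (hA : ∀ t x, (∀ i, c i x = pt i) → ∀ i, c i (Φ (t, x)) = pt i)
    (a : X) (ha : ∀ i, c i a = pt i) (h1 : ∀ x, (∀ i, c i x = pt i) → Φ (1, x) = a) :
    Nonempty (ContinuousMap.HomotopyEquiv X (PWedge Y pt)) := by
  classical
  have : T2Space (PWedge Y pt) :=
    T2Space.of_injective_continuous (wedgeToPi_injective pt) (continuous_wedgeToPi pt)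
  have hemb := ((continuous_wedgeToPi pt).isClosedEmbedding (wedgeToPi_injective pt))
  have hex : ∀ x, ∃ v, wedgeToPi pt v = fun i => c i x := by
    intro x
    by_cases hx : ∀ i, c i x = pt i
    · exact ⟨Quot.mk _ (Sum.inr ()), funext fun i => (hx i).symm⟩
    · push Not at hx
      obtain ⟨i, hi⟩ := hx
      refine ⟨Quot.mk _ (Sum.inl ⟨i, c i x⟩), funext fun j => ?_⟩
      change Function.update pt i (c i x) j = _
      by_cases hj : j = i
      · subst hj; simp
      · rw [Function.update_of_ne hj]
        by_contra hne
        exact hj (hdisj j i x (Ne.symm hne) hi)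
  choose q hq using hex
  have hqc : Continuous q := by
    rw [hemb.isInducing.continuous_iff]
    have : wedgeToPi pt ∘ q = fun x i => c i x := funext hq
    rw [this]
    exact continuous_pi hc
  have hqeq : ∀ x y, q x = q y → x = y ∨ (∀ i, c i x = pt i) ∧ ∀ i, c i y = pt i := by
    intro x y hxy
    have h : ∀ i, c i x = c i y := fun i => by
      have := (hq x).symm.trans ((congrArg _ hxy).trans (hq y))
      exact congrFun this i
    by_cases hx : ∀ i, c i x = pt i
    · exact Or.inr ⟨hx, fun i => (h i) ▸ hx i⟩
    · push Not at hx
      obtain ⟨i, hi⟩ := hx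
      exact Or.inl (hinj i x y (h i) hi)
  have hqA : ∀ x y, (∀ i, c i x = pt i) → (∀ i, c i y = pt i) → q x = q y := by
    intro x y hx hy
    apply wedgeToPi_injective
    rw [hq, hq]
    funext i
    rw [hx, hy]
  have hqs : Function.Surjective q := by
    rintro ⟨v⟩
    have hbase : ∀ v : (Σ i, Y i) ⊕ Unit, wedgeToPi pt (Quot.mk _ v) = pt →
        q a = Quot.mk _ v := fun v hv => by
      apply wedgeToPi_injective
      rw [hq, hv]
      exact funext ha
    rcases v with ⟨i, y⟩ | _
    · by_cases hy : y = pt i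
      · subst hy
        exact ⟨a, hbase _ (Function.update_eq_self i pt)⟩
      · obtain ⟨x, rfl⟩ := hsurj i y
        refine ⟨x, wedgeToPi_injective pt ?_⟩
        rw [hq]
        funext j
        change _ = Function.update pt i (c i x) j
        by_cases hj : j = i
        · subst hj; simp
        · rw [Function.update_of_ne hj]
          by_contra hne
          exact hj (hdisj j i x hne hy)
    · exact ⟨a, hbase _ rfl⟩
  have hQ : Topology.IsQuotientMap q :=
    Topology.IsQuotientMap.of_surjective_continuous hqs hqc
  have hQ2 : Topology.IsQuotientMap (Prod.map id q : unitInterval × X → unitInterval × _) :=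
    Topology.IsQuotientMap.of_surjective_continuous (Function.surjective_id.prodMap hqs)
      (continuous_id.prodMap hqc)
  let qm : C(X, PWedge Y pt) := ⟨q, hqc⟩
  let Φ₁ : C(X, X) := ⟨fun x => Φ (1, x), by fun_prop⟩
  have hg : Function.FactorsThrough Φ₁ qm := by
    intro x y hxy
    rcases hqeq x y hxy with rfl | ⟨hx, hy⟩
    · rfl
    · exact (h1 x hx).trans (h1 y hy).symm
  let g : C(PWedge Y pt, X) := hQ.lift (f := qm) Φ₁ hg
  have hgq : ∀ x, g (q x) = Φ (1, x) := fun x =>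
    congrArg (fun f : C(X, X) => f x) (hQ.lift_comp (f := qm) Φ₁ hg)
  let Q : C(unitInterval × X, unitInterval × PWedge Y pt) := ⟨Prod.map id q, hQ2.continuous⟩
  have hH : Function.FactorsThrough (qm.comp Φ) Q := by
    rintro ⟨s, x⟩ ⟨t, y⟩ hxy
    obtain ⟨hst, hq'⟩ := Prod.mk.inj hxy
    obtain rfl : s = t := hst
    rcases hqeq x y hq' with rfl | ⟨hx, hy⟩
    · rfl
    · exact hqA _ _ (hA s x hx) (hA s y hy)
  let H : C(unitInterval × PWedge Y pt, PWedge Y pt) := hQ2.lift (f := Q) (qm.comp Φ) hH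
  have hHq : ∀ t x, H (t, q x) = q (Φ (t, x)) := fun t x =>
    congrArg (fun f : C(unitInterval × X, PWedge Y pt) => f (t, x))
      (hQ2.lift_comp (f := Q) (qm.comp Φ) hH)
  refine ⟨⟨qm, g, ?_, ?_⟩⟩
  · refine ContinuousMap.Homotopic.symm ⟨⟨Φ, fun x => h0 x, fun x => ?_⟩⟩
    exact (hgq x).symm
  · refine ContinuousMap.Homotopic.symm ⟨⟨H, fun v => ?_, fun v => ?_⟩⟩
    · obtain ⟨x, rfl⟩ := hqs v
      exact (hHq 0 x).trans (congrArg q (h0 x))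
    · obtain ⟨x, rfl⟩ := hqs v
      exact (hHq 1 x).trans (congrArg q (hgq x).symm)

/-- An open partial homeomorphism onto the complement of a point extends by that point. -/
theorem continuous_collapse {X S : Type*} [TopologicalSpace X] [T2Space X] [TopologicalSpace S]
    [CompactSpace S] (ψ : OpenPartialHomeomorph X S) (p : S) (hp : ψ.target = {p}ᶜ)
    [DecidablePred (· ∈ ψ.source)] :
    Continuous fun x => if x ∈ ψ.source then ψ x else p := by
  rw [continuous_def]
  intro N hN
  by_cases hpN : p ∈ N
  · have hsub : Nᶜ ⊆ ψ.target := by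
      rw [hp]
      intro y hy hyp
      exact hy (hyp ▸ hpN)
    have hK : IsCompact (ψ.symm '' Nᶜ) :=
      hN.isClosed_compl.isCompact.image_of_continuousOn (ψ.continuousOn_symm.mono hsub)
    convert! hK.isClosed.isOpen_compl using 1
    ext x
    simp only [Set.mem_preimage, Set.mem_compl_iff, Set.mem_image, not_exists, not_and]
    constructor
    · rintro hx y hy rfl
      rw [if_pos (ψ.map_target (hsub hy)), ψ.right_inv (hsub hy)] at hx
      exact hy hx
    · intro h
      split_ifs with hx
      · by_contra hn
        exact h _ hn (ψ.left_inv hx)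
      · exact hpN
  · convert! ψ.isOpen_inter_preimage hN using 1
    ext x
    simp only [Set.mem_preimage, Set.mem_inter_iff]
    split_ifs with hx <;> simp [hx, hpN]

end WedgeQuotient

section Softmax

/-- The coordinates `(1, exp y₁, …, exp y_d)`. -/
noncomputable def expCons {d : ℕ} (y : EuclideanSpace ℝ (Fin d)) : Fin (d + 1) → ℝ :=
  Fin.cons 1 fun i => Real.exp (y i)

theorem expCons_pos {d : ℕ} (y : EuclideanSpace ℝ (Fin d)) (i : Fin (d + 1)) : 0 < expCons y i := by
  refine Fin.cases ?_ (fun i => ?_) i <;> simp [expCons, Real.exp_pos]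

theorem expCons_sum_pos {d : ℕ} (y : EuclideanSpace ℝ (Fin d)) : 0 < ∑ i, expCons y i :=
  Finset.sum_pos (fun i _ => expCons_pos y i) Finset.univ_nonempty

theorem continuous_expCons {d : ℕ} : Continuous (expCons (d := d)) := by
  refine continuous_pi fun i => ?_
  refine Fin.cases ?_ (fun i => ?_) i
  · simpa [expCons] using continuous_const
  · simp only [expCons, Fin.cons_succ]
    fun_prop

variable {α : Type*}

open Classical in
/-- The point of the open simplex spanned by `g` with logarithmic coordinates `y`. -/
noncomputable def softmax {d : ℕ} (g : Fin (d + 1) ↪ α) (y : EuclideanSpace ℝ (Fin d)) (a : α) : ℝ :=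
  ∑ i, if g i = a then expCons y i / ∑ j, expCons y j else 0

theorem softmax_apply {d : ℕ} (g : Fin (d + 1) ↪ α) (y : EuclideanSpace ℝ (Fin d))
    (i : Fin (d + 1)) : softmax g y (g i) = expCons y i / ∑ j, expCons y j := by
  simp [softmax]

theorem softmax_of_notMem {d : ℕ} (g : Fin (d + 1) ↪ α) (y : EuclideanSpace ℝ (Fin d))
    {a : α} (ha : a ∉ Finset.univ.map g) : softmax g y a = 0 := by
  refine Finset.sum_eq_zero fun i _ => if_neg ?_
  rintro rfl
  simp at ha

theorem softmax_nonneg {d : ℕ} (g : Fin (d + 1) ↪ α) (y : EuclideanSpace ℝ (Fin d)) (a : α) :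
    0 ≤ softmax g y a := by
  refine Finset.sum_nonneg fun i _ => ?_
  split_ifs
  · exact div_nonneg (expCons_pos y i).le (expCons_sum_pos y).le
  · exact le_rfl

theorem continuous_softmax {d : ℕ} (g : Fin (d + 1) ↪ α) : Continuous (softmax g) := by
  refine continuous_pi fun a => continuous_finsetSum _ fun i _ => ?_
  split_ifs
  · refine Continuous.div ?_ ?_ fun y => (expCons_sum_pos y).ne'
    · exact (continuous_apply i).comp continuous_expCons
    · exact continuous_finsetSum _ fun j _ => (continuous_apply j).comp continuous_expCons
  · exact continuous_const

end Softmax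

section Realization

variable {α : Type*} [Fintype α]

open Classical in
/-- The support of a function on a finite type. -/
noncomputable def supp (f : α → ℝ) : Finset α := Finset.univ.filter fun a => f a ≠ 0

theorem mem_supp {f : α → ℝ} {a : α} : a ∈ supp f ↔ f a ≠ 0 := by simp [supp]

theorem mem_realization_iff {K : Set (Finset α)} (hK : IsLowerSet K) (f : α → ℝ) :
    ((∀ a, 0 ≤ f a) ∧ ∃ s ∈ K, (∀ a, f a ≠ 0 → a ∈ s) ∧ ∑ a ∈ s, f a = 1) ↔
      (∀ a, 0 ≤ f a) ∧ supp f ∈ K ∧ ∑ a, f a = 1 := by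
  have key : ∀ s : Finset α, (∀ a, f a ≠ 0 → a ∈ s) → ∑ a ∈ s, f a = ∑ a, f a := fun s hs =>
    Finset.sum_subset (Finset.subset_univ s) fun a _ ha => by
      by_contra h
      exact ha (hs a h)
  refine and_congr_right fun _ => ⟨?_, ?_⟩
  · rintro ⟨s, hs, h1, h2⟩
    exact ⟨hK (fun a ha => h1 a (mem_supp.1 ha)) hs, key s h1 ▸ h2⟩
  · rintro ⟨h1, h2⟩
    exact ⟨_, h1, fun a => mem_supp.2, by rw [key _ fun a => mem_supp.2, h2]⟩

/-- A point of the realization from its barycentric coordinates. -/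
def Realization.mk {K : Set (Finset α)} (hK : IsLowerSet K) (f : α → ℝ) (h0 : ∀ a, 0 ≤ f a)
    (hs : supp f ∈ K) (h1 : ∑ a, f a = 1) : Realization K :=
  ⟨f, (mem_realization_iff hK f).2 ⟨h0, hs, h1⟩⟩

theorem Realization.supp_mem {K : Set (Finset α)} (hK : IsLowerSet K) (x : Realization K) :
    supp x.1 ∈ K := ((mem_realization_iff hK x.1).1 x.2).2.1

theorem Realization.sum_eq_one {K : Set (Finset α)} (x : Realization K) : ∑ a, x.1 a = 1 := by
  obtain ⟨s, -, h1, h2⟩ := x.2.2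
  refine (Finset.sum_subset (Finset.subset_univ s) fun a _ ha => ?_).symm.trans h2
  by_contra h
  exact ha (h1 a h)

theorem Realization.compactSpace {K : Set (Finset α)} (hK : IsLowerSet K) :
    CompactSpace (Realization K) := by
  have hsub : {f : α → ℝ | (∀ a, 0 ≤ f a) ∧ ∃ s ∈ K, (∀ a, f a ≠ 0 → a ∈ s) ∧ ∑ a ∈ s, f a = 1} =
      stdSimplex ℝ α ∩ ⋃ s ∈ K, {f | ∀ a ∉ s, f a = 0} := by
    ext f
    rw [Set.mem_ofPred_eq, mem_realization_iff hK]
    simp only [stdSimplex, Set.mem_inter_iff, Set.mem_ofPred_eq, Set.mem_iUnion, exists_prop]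
    constructor
    · rintro ⟨h0, hs, h1⟩
      refine ⟨⟨h0, h1⟩, _, hs, fun a ha => ?_⟩
      simpa [mem_supp] using ha
    · rintro ⟨⟨h0, h1⟩, s, hs, h⟩
      refine ⟨h0, hK (fun a ha => ?_) hs, h1⟩
      by_contra hn
      exact mem_supp.1 ha (h a hn)
  have hclosed : IsClosed (⋃ s ∈ K, {f : α → ℝ | ∀ a ∉ s, f a = 0}) := by
    refine (Set.toFinite K).isClosed_biUnion fun s _ => ?_
    simp only [Set.ofPred_forall]
    exact isClosed_iInter fun a => isClosed_iInter fun _ =>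
      isClosed_eq (continuous_apply a) continuous_const
  have hcompact : IsCompact {f : α → ℝ | (∀ a, 0 ≤ f a) ∧
      ∃ s ∈ K, (∀ a, f a ≠ 0 → a ∈ s) ∧ ∑ a ∈ s, f a = 1} := by
    rw [hsub]
    exact (isCompact_stdSimplex ℝ α).inter_right hclosed
  exact isCompact_iff_compactSpace.1 hcompact

theorem softmax_sum {d : ℕ} (g : Fin (d + 1) ↪ α) (y : EuclideanSpace ℝ (Fin d)) :
    ∑ a, softmax g y a = 1 := by
  classical
  unfold softmax
  rw [Finset.sum_comm]
  have : ∀ i, (∑ a, if g i = a then expCons y i / ∑ j, expCons y j else 0) =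
      expCons y i / ∑ j, expCons y j := fun i => by simp
  rw [Finset.sum_congr rfl fun i _ => this i, ← Finset.sum_div, div_self (expCons_sum_pos y).ne']

theorem supp_softmax_subset {d : ℕ} (g : Fin (d + 1) ↪ α) (y : EuclideanSpace ℝ (Fin d)) :
    supp (softmax g y) ⊆ Finset.univ.map g := by
  intro a ha
  by_contra hn
  exact mem_supp.1 ha (softmax_of_notMem g y hn)

/-- The interior of a facet is an open cell. -/
noncomputable def facetChart {K : Set (Finset α)} (hK : IsLowerSet K) {d : ℕ} (g : Fin (d + 1) ↪ α)
    (hg : Finset.univ.map g ∈ K) (hmax : ∀ s ∈ K, Finset.univ.map g ⊆ s → s = Finset.univ.map g) :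
    OpenPartialHomeomorph (Realization K) (EuclideanSpace ℝ (Fin d)) where
  toFun x := WithLp.toLp 2 fun i => Real.log (x.1 (g i.succ)) - Real.log (x.1 (g 0))
  invFun y := Realization.mk hK (softmax g y) (softmax_nonneg g y)
    (hK (supp_softmax_subset g y) hg) (softmax_sum g y)
  source := {x | ∀ i, 0 < x.1 (g i)}
  target := Set.univ
  map_source' _ _ := Set.mem_univ _
  map_target' y _ i := by
    change 0 < softmax g y (g i)
    rw [softmax_apply]
    exact div_pos (expCons_pos y i) (expCons_sum_pos y)
  left_inv' x hx := by
    have hsupp : supp x.1 = Finset.univ.map g := by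
      refine hmax _ (x.supp_mem hK) fun a ha => ?_
      obtain ⟨i, -, rfl⟩ := Finset.mem_map.1 ha
      exact mem_supp.2 (hx i).ne'
    have hexp : ∀ i, expCons (WithLp.toLp 2 fun i : Fin d =>
        Real.log (x.1 (g i.succ)) - Real.log (x.1 (g 0))) i = x.1 (g i) / x.1 (g 0) := by
      intro i
      refine Fin.cases ?_ (fun i => ?_) i
      · simp [expCons, div_self (hx 0).ne']
      · simp only [expCons, Fin.cons_succ]
        rw [Real.exp_sub, Real.exp_log (hx _), Real.exp_log (hx _)]
    have hsum : ∑ i, x.1 (g i) = 1 := by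
      rw [← Finset.sum_map Finset.univ g x.1]
      refine (Finset.sum_subset (Finset.subset_univ _) fun a _ ha => ?_).trans x.sum_eq_one
      rw [← hsupp, mem_supp, not_not] at ha
      exact ha
    refine Subtype.ext (funext fun a => ?_)
    change softmax g _ a = x.1 a
    by_cases ha : a ∈ Finset.univ.map g
    · obtain ⟨i, -, rfl⟩ := Finset.mem_map.1 ha
      rw [softmax_apply]
      simp only [hexp]
      rw [← Finset.sum_div, hsum]
      have := (hx 0).ne'
      field_simp
    · rw [softmax_of_notMem g _ ha]
      rw [← hsupp, mem_supp, not_not] at ha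
      exact ha.symm
  right_inv' y _ := by
    ext i
    change Real.log (softmax g y (g i.succ)) - Real.log (softmax g y (g 0)) = y i
    have h := (expCons_sum_pos y).ne'
    rw [softmax_apply, softmax_apply, Real.log_div (expCons_pos y _).ne' h,
      Real.log_div (expCons_pos y _).ne' h]
    simp [expCons]
  open_source := by
    simp only [Set.ofPred_forall]
    exact isOpen_iInter_of_finite fun i =>
      isOpen_lt continuous_const ((continuous_apply _).comp continuous_subtype_val)
  open_target := isOpen_univ
  continuousOn_toFun := by
    refine (PiLp.continuous_toLp 2 _).comp_continuousOn (continuousOn_pi.2 fun i => ?_)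
    have h : ∀ i, ContinuousOn (fun x : Realization K => Real.log (x.1 (g i)))
        {x | ∀ i, 0 < x.1 (g i)} := fun i =>
      ContinuousOn.log ((continuous_apply _).comp continuous_subtype_val).continuousOn
        fun x hx => (hx i).ne'
    exact (h _).sub (h _)
  continuousOn_invFun := ((continuous_softmax g).subtype_mk _).continuousOn

/-- The quotient map of a facet by its boundary, extended to the whole complex. -/
theorem exists_facet_collapse {K : Set (Finset α)} (hK : IsLowerSet K) {d : ℕ}
    (g : Fin (d + 1) ↪ α) (hg : Finset.univ.map g ∈ K)
    (hmax : ∀ s ∈ K, Finset.univ.map g ⊆ s → s = Finset.univ.map g) :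
    ∃ c : Realization K → SphereD d, Continuous c ∧
      (∀ x, c x ≠ SphereD.pt d ↔ ∀ i, 0 < x.1 (g i)) ∧
      (∀ x y, c x = c y → c x ≠ SphereD.pt d → x = y) ∧
      ∀ v, v ≠ SphereD.pt d → ∃ x, c x = v := by
  classical
  have : Fact (Module.finrank ℝ (EuclideanSpace ℝ (Fin (d + 1))) = d + 1) := ⟨by simp⟩
  let st := (stereographic' (E := EuclideanSpace ℝ (Fin (d + 1))) d (SphereD.pt d))
  let ψ := (facetChart hK g hg hmax).trans st.symm
  have hsrc : ∀ x, x ∈ ψ.source ↔ ∀ i, 0 < x.1 (g i) := by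
    intro x
    simp [ψ, st, facetChart]
  have htgt : ψ.target = {SphereD.pt d}ᶜ := by
    simp [ψ, st, facetChart]
  have hne : ∀ x, (if x ∈ ψ.source then ψ x else SphereD.pt d) ≠ SphereD.pt d ↔ x ∈ ψ.source := by
    intro x
    split_ifs with hx
    · have := ψ.map_source hx
      rw [htgt] at this
      exact iff_of_true this hx
    · exact iff_of_false (fun h => h rfl) hx
  refine ⟨fun x => if x ∈ ψ.source then ψ x else SphereD.pt d,
    continuous_collapse ψ _ htgt, fun x => (hne x).trans (hsrc x), fun x y hxy hx => ?_,
    fun v hv => ?_⟩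
  · have hy : y ∈ ψ.source := (hne y).1 fun h => hx (hxy.trans h)
    have hx := (hne x).1 hx
    simp only [if_pos hx, if_pos hy] at hxy
    exact ψ.injOn hx hy hxy
  · have hv : v ∈ ψ.target := htgt ▸ hv
    exact ⟨ψ.symm v, by simp only [if_pos (ψ.map_target hv)]; exact ψ.right_inv hv⟩

end Realization

section Collapse

variable {α : Type*}

/-- The minimum of `f` over a nonempty finite set. -/
noncomputable def minCoord (P : Finset α) (f : α → ℝ) : ℝ := if h : P.Nonempty then P.inf' h f else 0

theorem continuous_minCoord (P : Finset α) : Continuous (minCoord P) := by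
  by_cases h : P.Nonempty
  · rw [show minCoord P = fun f => P.inf' h f from funext fun f => dif_pos h]
    exact Continuous.finset_inf'_apply h fun a _ => continuous_apply a
  · rw [show minCoord P = fun _ => 0 from funext fun f => dif_neg h]
    exact continuous_const

theorem minCoord_le {P : Finset α} (f : α → ℝ) {a : α} (ha : a ∈ P) : minCoord P f ≤ f a := by
  have h : P.Nonempty := ⟨a, ha⟩
  simp only [minCoord, h, dif_pos]
  exact Finset.inf'_le f ha

theorem minCoord_nonneg {P : Finset α} {f : α → ℝ} (hf : ∀ a, 0 ≤ f a) : 0 ≤ minCoord P f := by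
  by_cases h : P.Nonempty
  · simp only [minCoord, h, dif_pos]
    exact Finset.le_inf' h f fun a _ => hf a
  · simp [minCoord, h]

theorem exists_eq_minCoord {P : Finset α} (hP : P.Nonempty) (f : α → ℝ) :
    ∃ a ∈ P, f a = minCoord P f := by
  obtain ⟨a, ha, h⟩ := Finset.exists_mem_eq_inf' hP f
  refine ⟨a, ha, ?_⟩
  simp only [minCoord, hP, dif_pos]
  exact h.symm

open Classical in
/-- The indicator function of a finite set. -/
noncomputable def chi (P : Finset α) (a : α) : ℝ := if a ∈ P then 1 else 0

theorem chi_of_mem {P : Finset α} {a : α} (h : a ∈ P) : chi P a = 1 := if_pos h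

theorem chi_of_notMem {P : Finset α} {a : α} (h : a ∉ P) : chi P a = 0 := if_neg h

theorem minCoord_mul_chi_le {P : Finset α} {f : α → ℝ} (hf : ∀ a, 0 ≤ f a) (a : α) :
    minCoord P f * chi P a ≤ f a := by
  by_cases h : a ∈ P
  · rw [chi_of_mem h, mul_one]
    exact minCoord_le f h
  · rw [chi_of_notMem h, mul_zero]
    exact hf a

variable [Fintype α]

theorem sum_chi (P : Finset α) : ∑ a, chi P a = P.card := by
  classical
  simp [chi]

theorem minCoord_pos {P : Finset α} (hP : P.Nonempty) {f : α → ℝ} (hf : ∀ a, 0 ≤ f a)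
    (h : P ⊆ supp f) : 0 < minCoord P f := by
  obtain ⟨a, ha, h'⟩ := exists_eq_minCoord hP f
  rw [← h']
  exact lt_of_le_of_ne (hf a) (mem_supp.1 (h ha)).symm

theorem minCoord_eq_zero {P : Finset α} {f : α → ℝ} (hf : ∀ a, 0 ≤ f a)
    (h : ¬ P ⊆ supp f) : minCoord P f = 0 := by
  obtain ⟨a, ha, h'⟩ := Finset.not_subset.1 h
  rw [mem_supp, not_not] at h'
  exact le_antisymm (h' ▸ minCoord_le f ha) (minCoord_nonneg hf)

/-- The inclusion of realizations induced by an inclusion of complexes. -/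
def Realization.inclusion {L K : Set (Finset α)} (h : L ⊆ K) : C(Realization L, Realization K) where
  toFun x := ⟨x.1, x.2.1, x.2.2.imp fun _ hs => ⟨h hs.1, hs.2⟩⟩
  continuous_toFun := continuous_subtype_val.subtype_mk _

theorem Realization.nullhomotopic_inclusion_of_cone {L : Set (Finset α)}
    (hL : IsLowerSet L) (a : α) (hne : L.Nonempty)
    (hins : ∀ s ∈ L, ∃ s' ∈ L, a ∈ s' ∧ s ⊆ s') :
    (Realization.inclusion (subset_refl L)).Nullhomotopic := by
  classical
  have hval : ∀ t : unitInterval, (0 : ℝ) ≤ t ∧ (t : ℝ) ≤ 1 := fun t => t.2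
  have hchi : ∀ b, 0 ≤ chi {a} b := fun b => by unfold chi; split_ifs <;> norm_num
  have hsa : {a} ∈ L := by
    obtain ⟨s, hs⟩ := hne
    obtain ⟨s', hs', ha, -⟩ := hins s hs
    exact hL (Finset.singleton_subset_iff.2 ha) hs'
  refine ⟨Realization.mk hL (chi {a}) hchi (hL ?_ hsa) ?_, ⟨⟨⟨fun p => Realization.mk hL
    (fun b => (1 - (p.1 : ℝ)) * p.2.1 b + p.1 * chi {a} b) ?_ ?_ ?_, ?_⟩, ?_, ?_⟩⟩⟩
  · intro b hb
    by_contra hn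
    exact mem_supp.1 hb (chi_of_notMem hn)
  · rw [sum_chi]; simp
  · intro b
    exact add_nonneg (mul_nonneg (sub_nonneg.2 (hval p.1).2) (p.2.2.1 b))
      (mul_nonneg (hval p.1).1 (hchi b))
  · obtain ⟨s', hs', ha, hs⟩ := hins _ (p.2.supp_mem hL)
    refine hL (fun b hb => ?_) hs'
    by_contra hn
    refine mem_supp.1 hb ?_
    have h1 : p.2.1 b = 0 := by
      by_contra h
      exact hn (hs (mem_supp.2 h))
    have h2 : chi {a} b = 0 := chi_of_notMem fun h => hn (Finset.mem_singleton.1 h ▸ ha)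
    simp [h1, h2]
  · rw [Finset.sum_add_distrib, ← Finset.mul_sum, ← Finset.mul_sum, p.2.sum_eq_one, sum_chi]
    simp
  · refine Continuous.subtype_mk (continuous_pi fun b => ?_) _
    have : Continuous fun p : unitInterval × Realization L => p.2.1 b :=
      (continuous_apply b).comp (continuous_subtype_val.comp continuous_snd)
    fun_prop
  · intro x
    refine Subtype.ext (funext fun b => ?_)
    simp [Realization.mk, Realization.inclusion]
  · intro x
    refine Subtype.ext (funext fun b => ?_)
    simp [Realization.mk]

/-- If every face of `L` outside `L'` contains a unique face of a family `C`, which can be pushed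
away from towards `a`, then `L` deforms into `L'`. -/
theorem Realization.nullhomotopic_inclusion_of_collapse {K L L' : Set (Finset α)} [DecidableEq α]
    (hL : IsLowerSet L) (hL' : IsLowerSet L') (hLK : L ⊆ K) (hL'K : L' ⊆ K)
    (hL'L : L' ⊆ L) (C : Finset (Finset α)) (a : α) (hne : ∀ P ∈ C, P.Nonempty)
    (haP : ∀ P ∈ C, a ∉ P)
    (huniq : ∀ s ∈ L, ∀ P ∈ C, ∀ Q ∈ C, P ⊆ s → Q ⊆ s → P = Q)
    (hins : ∀ s ∈ L, ∀ P ∈ C, P ⊆ s → insert a s ∈ L)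
    (hdel : ∀ s ∈ L, ∀ P ∈ C, P ⊆ s → ∀ p ∈ P, (insert a s).erase p ∈ L')
    (hcov : ∀ s ∈ L, s ∉ L' → ∃ P ∈ C, P ⊆ s)
    (hnull : (Realization.inclusion hL'K).Nullhomotopic) :
    (Realization.inclusion hLK).Nullhomotopic := by
  let push : ℝ → (α → ℝ) → α → ℝ := fun t x b =>
    x b + t * ∑ P ∈ C, minCoord P x * (P.card * chi {a} b - chi P b)
  have hcases : ∀ x : Realization L, (supp x.1 ∈ L' ∧ ∀ t, push t x.1 = x.1) ∨
      ∃ P ∈ C, P ⊆ supp x.1 ∧ ∀ t b, push t x.1 b =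
        x.1 b + t * (minCoord P x.1 * (P.card * chi {a} b - chi P b)) := by
    intro x
    by_cases h : ∃ P ∈ C, P ⊆ supp x.1
    · obtain ⟨P, hP, hPx⟩ := h
      refine Or.inr ⟨P, hP, hPx, fun t b => ?_⟩
      simp only [push]
      rw [Finset.sum_eq_single_of_mem P hP fun Q hQ hQP => ?_]
      rw [minCoord_eq_zero x.2.1 fun hQx =>
        hQP (huniq _ (x.supp_mem hL) Q hQ P hP hQx hPx), zero_mul]
    · refine Or.inl ⟨?_, fun t => funext fun b => ?_⟩
      · by_contra hn
        exact h (hcov _ (x.supp_mem hL) hn)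
      · simp only [push]
        rw [Finset.sum_eq_zero fun P hP => ?_, mul_zero, add_zero]
        rw [minCoord_eq_zero x.2.1 fun hPx => h ⟨P, hP, hPx⟩, zero_mul]
  have hsum : ∀ t, ∀ x : Realization L, ∑ b, push t x.1 b = 1 := by
    intro t x
    simp only [push]
    rw [Finset.sum_add_distrib, x.sum_eq_one, ← Finset.mul_sum, Finset.sum_comm,
      Finset.sum_eq_zero, mul_zero, add_zero]
    intro P _
    rw [← Finset.mul_sum, Finset.sum_sub_distrib, ← Finset.mul_sum, sum_chi, sum_chi]
    simp
  have hnonneg : ∀ t : unitInterval, ∀ x : Realization L, ∀ b, 0 ≤ push t x.1 b := by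
    intro t x b
    rcases hcases x with ⟨-, h⟩ | ⟨P, hP, hPx, h⟩
    · rw [h]
      exact x.2.1 b
    · rw [h]
      have h1 := minCoord_mul_chi_le (P := P) x.2.1 b
      have h2 : 0 ≤ minCoord P x.1 * (P.card * chi {a} b) :=
        mul_nonneg (minCoord_nonneg x.2.1) (mul_nonneg (Nat.cast_nonneg _)
          (by unfold chi; split_ifs <;> norm_num))
      have h3 : 0 ≤ minCoord P x.1 * chi P b :=
        mul_nonneg (minCoord_nonneg x.2.1) (by unfold chi; split_ifs <;> norm_num)
      have h4 := t.2.1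
      have h5 := t.2.2
      nlinarith [mul_nonneg h4 h2, mul_nonneg (sub_nonneg.2 h5) h3]
  have hzero : ∀ x : Realization L, ∀ P : Finset α, ∀ b, b ∉ insert a (supp x.1) → P ⊆ supp x.1 →
      x.1 b = 0 ∧ chi {a} b = 0 ∧ chi P b = 0 := by
    intro x P b hb hP
    rw [Finset.mem_insert, not_or] at hb
    refine ⟨by simpa [mem_supp] using hb.2, chi_of_notMem (by simpa using hb.1),
      chi_of_notMem fun h => hb.2 (hP h)⟩
  have hsupp : ∀ t, ∀ x : Realization L, supp (push t x.1) ∈ L := by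
    intro t x
    rcases hcases x with ⟨-, h⟩ | ⟨P, hP, hPx, h⟩
    · rw [h]
      exact x.supp_mem hL
    · refine hL (fun b hb => ?_) (hins _ (x.supp_mem hL) P hP hPx)
      by_contra hn
      refine mem_supp.1 hb ?_
      obtain ⟨h1, h2, h3⟩ := hzero x P b hn hPx
      rw [h, h1, h2, h3]
      ring
  have hsupp1 : ∀ x : Realization L, supp (push 1 x.1) ∈ L' := by
    intro x
    rcases hcases x with ⟨h', h⟩ | ⟨P, hP, hPx, h⟩
    · rwa [h]
    · obtain ⟨p, hp, hpm⟩ := exists_eq_minCoord (hne P hP) x.1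
      refine hL' (fun b hb => ?_) (hdel _ (x.supp_mem hL) P hP hPx p hp)
      by_contra hn
      refine mem_supp.1 hb ?_
      rw [Finset.mem_erase, not_and_or, not_not] at hn
      rw [h]
      rcases hn with rfl | hn
      · have : b ∉ ({a} : Finset α) := fun hba => haP P hP (Finset.mem_singleton.1 hba ▸ hp)
        rw [chi_of_mem hp, chi_of_notMem this, hpm]
        ring
      · obtain ⟨h1, h2, h3⟩ := hzero x P b hn hPx
        rw [h1, h2, h3]
        ring
  have hcont : Continuous fun p : unitInterval × Realization L => push p.1 p.2.1 := by
    refine continuous_pi fun b => ?_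
    have hx : Continuous fun p : unitInterval × Realization L => p.2.1 :=
      continuous_subtype_val.comp continuous_snd
    have hxb : Continuous fun p : unitInterval × Realization L => p.2.1 b :=
      (continuous_apply b).comp hx
    refine hxb.add (Continuous.mul (by fun_prop) (continuous_finsetSum _ fun P _ => ?_))
    exact ((continuous_minCoord P).comp hx).mul continuous_const
  let r : C(Realization L, Realization L') :=
    ⟨fun x => Realization.mk hL' (push 1 x.1) (by simpa using hnonneg 1 x) (hsupp1 x) (hsum 1 x),
      (hcont.comp (Continuous.prodMk_right (1 : unitInterval))).subtype_mk _⟩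
  have hhom : ContinuousMap.Homotopic (ContinuousMap.id (Realization L))
      ((Realization.inclusion hL'L).comp r) := by
    refine ⟨⟨⟨fun p => Realization.mk hL (push p.1 p.2.1) (hnonneg p.1 p.2) (hsupp p.1 p.2)
      (hsum p.1 p.2), hcont.subtype_mk _⟩, fun x => ?_, fun x => ?_⟩⟩
    · refine Subtype.ext (funext fun b => ?_)
      simp [Realization.mk, push]
    · refine Subtype.ext (funext fun b => ?_)
      simp [Realization.mk, Realization.inclusion, r]
  obtain ⟨y, hy⟩ := hnull.comp_left r
  refine ⟨y, ContinuousMap.Homotopic.trans ?_ hy⟩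
  exact ContinuousMap.Homotopic.comp (.refl (Realization.inclusion hLK)) hhom

end Collapse

section FacetExtension

variable {α : Type*} [Fintype α]

/-- A null-homotopy of the complement of a family of facets extends to the whole complex. -/
theorem Realization.exists_homotopy_extension {ι : Type*} [Fintype ι] {K : Set (Finset α)}
    (hK : IsLowerSet K) (F : ι → Finset α) (hne : ∀ i, (F i).Nonempty)
    (hinj : Function.Injective F) (hF : ∀ i, F i ∈ K) (hmax : ∀ i, ∀ s ∈ K, F i ⊆ s → s = F i)
    (hnull : (ContinuousMap.id (Realization (K \ Set.range F))).Nullhomotopic) :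
    ∃ (Φ : C(unitInterval × Realization K, Realization K)) (a : Realization K),
      (∀ x, Φ (0, x) = x) ∧ supp a.1 ∉ Set.range F ∧
      (∀ t x, supp x.1 ∉ Set.range F → supp (Φ (t, x)).1 ∉ Set.range F) ∧
      ∀ x, supp x.1 ∉ Set.range F → Φ (1, x) = a := by
  classical
  set L := K \ Set.range F with hLdef
  have hLK : L ⊆ K := Set.sdiff_subset
  have hL : IsLowerSet L := by
    rintro s t hts ⟨hs, hsF⟩
    refine ⟨hK hts hs, ?_⟩
    rintro ⟨i, rfl⟩
    exact hsF ⟨i, (hmax i s hs hts).symm⟩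
  obtain ⟨a₀, ⟨h⟩⟩ := hnull
  let mass : (α → ℝ) → ℝ := fun x => ∑ i, (F i).card * minCoord (F i) x
  let core : (α → ℝ) → α → ℝ := fun x a => x a - ∑ i, minCoord (F i) x * chi (F i) a
  let bary : ℝ → (α → ℝ) → α → ℝ := fun t x a =>
    (core x a + ∑ i, max 0 (minCoord (F i) x - t / 2 / (F i).card) * chi (F i) a) / (1 - t / 2)
  have hcard : ∀ i, (0 : ℝ) < (F i).card := fun i => by exact_mod_cast (hne i).card_pos
  have hchi : ∀ (P : Finset α) b, 0 ≤ chi P b := fun P b => by unfold chi; split_ifs <;> norm_num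
  have hout : ∀ x : Realization K, supp x.1 ∉ Set.range F → ∀ i, minCoord (F i) x.1 = 0 := by
    intro x hx i
    exact minCoord_eq_zero x.2.1 fun hi => hx ⟨i, (hmax i _ (x.supp_mem hK) hi).symm⟩
  have hin : ∀ (x : Realization K) i, supp x.1 = F i → 0 < minCoord (F i) x.1 ∧
      ∀ j, j ≠ i → minCoord (F j) x.1 = 0 := by
    intro x i hx
    refine ⟨minCoord_pos (hne i) x.2.1 hx.ge, fun j hj => minCoord_eq_zero x.2.1 fun hji => hj ?_⟩
    exact hinj ((hmax j _ (x.supp_mem hK) hji).symm.trans hx)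
  have hmass_out : ∀ x : Realization K, supp x.1 ∉ Set.range F → mass x.1 = 0 := fun x hx =>
    Finset.sum_eq_zero fun i _ => by rw [hout x hx i, mul_zero]
  have hmass_in : ∀ (x : Realization K) i, supp x.1 = F i →
      mass x.1 = (F i).card * minCoord (F i) x.1 := fun x i hi =>
    Finset.sum_eq_single i (fun j _ hj => by rw [(hin x i hi).2 j hj, mul_zero]) (by simp)
  have hmass_nonneg : ∀ x : Realization K, 0 ≤ mass x.1 := fun x =>
    Finset.sum_nonneg fun i _ => mul_nonneg (hcard i).le (minCoord_nonneg x.2.1)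
  have hcore_out : ∀ x : Realization K, supp x.1 ∉ Set.range F → core x.1 = x.1 := by
    intro x hx
    funext b
    simp only [core]
    rw [Finset.sum_eq_zero fun i _ => by rw [hout x hx i, zero_mul], sub_zero]
  have hcore_in : ∀ (x : Realization K) i, supp x.1 = F i → ∀ b,
      core x.1 b = x.1 b - minCoord (F i) x.1 * chi (F i) b := by
    intro x i hi b
    simp only [core]
    rw [Finset.sum_eq_single i (fun j _ hj => by rw [(hin x i hi).2 j hj, zero_mul]) (by simp)]
  have hcore_nonneg : ∀ (x : Realization K) b, 0 ≤ core x.1 b := by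
    intro x b
    by_cases hx : supp x.1 ∈ Set.range F
    · obtain ⟨i, hi⟩ := hx
      rw [hcore_in x i hi.symm]
      exact sub_nonneg.2 (minCoord_mul_chi_le x.2.1 b)
    · rw [hcore_out x hx]
      exact x.2.1 b
  have hcore_sum : ∀ x : Realization K, ∑ b, core x.1 b = 1 - mass x.1 := by
    intro x
    simp only [core, mass]
    rw [Finset.sum_sub_distrib, x.sum_eq_one, Finset.sum_comm]
    congr 1
    refine Finset.sum_congr rfl fun i _ => ?_
    rw [← Finset.mul_sum, sum_chi, mul_comm]
  have hcore_supp : ∀ x : Realization K, supp (core x.1) ∈ L := by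
    intro x
    by_cases hx : supp x.1 ∈ Set.range F
    · obtain ⟨i, hi⟩ := hx
      obtain ⟨p, hp, hpm⟩ := exists_eq_minCoord (hne i) x.1
      have hsub : supp (core x.1) ⊆ (F i).erase p := by
        intro b hb
        rw [mem_supp, hcore_in x i hi.symm] at hb
        have hbF : b ∈ F i := by
          by_contra hn
          rw [chi_of_notMem hn] at hb
          rw [hi, mem_supp, not_not] at hn
          simp [hn] at hb
        refine Finset.mem_erase.2 ⟨?_, hbF⟩
        rintro rfl
        rw [chi_of_mem hp, hpm] at hb
        simp at hb
      refine hL hsub ⟨hK (Finset.erase_subset _ _) (hF i), ?_⟩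
      rintro ⟨j, hj⟩
      have h1 := hmax j (F i) (hF i) (hj ▸ Finset.erase_subset _ _)
      rw [← h1] at hj
      exact absurd hp (hj ▸ Finset.notMem_erase p (F i))
    · rw [hcore_out x hx]
      exact ⟨x.supp_mem hK, hx⟩
  have hcoord : Continuous fun p : unitInterval × Realization K => p.2.1 :=
    continuous_subtype_val.comp continuous_snd
  have hmin : ∀ i, Continuous fun p : unitInterval × Realization K => minCoord (F i) p.2.1 :=
    fun i => (continuous_minCoord _).comp hcoord
  have hmass_cont : Continuous fun p : unitInterval × Realization K => mass p.2.1 :=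
    continuous_finsetSum _ fun i _ => continuous_const.mul (hmin i)
  have hcore_cont : Continuous fun p : unitInterval × Realization K => core p.2.1 :=
    continuous_pi fun b => ((continuous_apply b).comp hcoord).sub
      (continuous_finsetSum _ fun i _ => (hmin i).mul continuous_const)
  have ht : ∀ t : unitInterval, (0 : ℝ) < 1 - t / 2 := fun t => by linarith [t.2.2]
  have hbary_cont : Continuous fun p : unitInterval × Realization K => bary p.1 p.2.1 := by
    refine continuous_pi fun b => ?_
    refine Continuous.div ?_ (by fun_prop) fun p => (ht p.1).ne'
    refine ((continuous_apply b).comp hcore_cont).add (continuous_finsetSum _ fun i _ => ?_)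
    exact (continuous_const.max ((hmin i).sub (by fun_prop))).mul continuous_const
  have hbary_nonneg : ∀ (t : unitInterval) (x : Realization K) b, 0 ≤ bary t x.1 b := fun t x b =>
    div_nonneg (add_nonneg (hcore_nonneg x b) (Finset.sum_nonneg fun i _ =>
      mul_nonneg (le_max_left _ _) (hchi _ _))) (ht t).le
  have hmax0 : ∀ (t : unitInterval) (x : Realization K) i, minCoord (F i) x.1 = 0 →
      max 0 (minCoord (F i) x.1 - t / 2 / (F i).card) = 0 := fun t x i h0 => by
    rw [h0, zero_sub, max_eq_left]
    exact neg_nonpos.2 (div_nonneg (by linarith [t.2.1]) (hcard i).le)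
  have hbary_out : ∀ (t : unitInterval) (x : Realization K), supp x.1 ∉ Set.range F → ∀ b,
      bary t x.1 b = x.1 b / (1 - t / 2) := by
    intro t x hx b
    simp only [bary]
    rw [Finset.sum_eq_zero fun i _ => by rw [hmax0 t x i (hout x hx i), zero_mul], add_zero,
      hcore_out x hx]
  have hbary_in : ∀ (t : unitInterval) (x : Realization K) i, supp x.1 = F i → ∀ b,
      bary t x.1 b = (core x.1 b +
        max 0 (minCoord (F i) x.1 - t / 2 / (F i).card) * chi (F i) b) / (1 - t / 2) := by
    intro t x i hi b
    simp only [bary]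
    rw [Finset.sum_eq_single i
      (fun j _ hj => by rw [hmax0 t x j ((hin x i hi).2 j hj), zero_mul]) (by simp)]
  have hbary_sum : ∀ (t : unitInterval) (x : Realization K), (t : ℝ) / 2 ≤ mass x.1 →
      ∑ b, bary t x.1 b = 1 := by
    intro t x hm
    by_cases hx : supp x.1 ∈ Set.range F
    · obtain ⟨i, hi⟩ := hx
      rw [hmass_in x i hi.symm] at hm
      have hle : (t : ℝ) / 2 / (F i).card ≤ minCoord (F i) x.1 := by
        rw [div_le_iff₀ (hcard i)]
        linarith
      simp only [hbary_in t x i hi.symm]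
      rw [← Finset.sum_div, Finset.sum_add_distrib, hcore_sum, ← Finset.mul_sum, sum_chi,
        max_eq_right (sub_nonneg.2 hle), hmass_in x i hi.symm, div_eq_one_iff_eq (ht t).ne']
      have := (hcard i).ne'
      field_simp
      ring
    · rw [hmass_out x hx] at hm
      have h0 : (t : ℝ) = 0 := le_antisymm (by linarith) t.2.1
      rw [Finset.sum_congr rfl fun b _ => hbary_out t x hx b]
      simpa [h0] using x.sum_eq_one
  have hbary_supp : ∀ (t : unitInterval) (x : Realization K), supp (bary t x.1) ∈ K := by
    intro t x
    refine hK (fun b hb => ?_) (x.supp_mem hK)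
    by_contra hn
    refine mem_supp.1 hb ?_
    have hxb : x.1 b = 0 := by simpa [mem_supp] using hn
    by_cases hx : supp x.1 ∈ Set.range F
    · obtain ⟨i, hi⟩ := hx
      rw [hbary_in t x i hi.symm, hcore_in x i hi.symm, chi_of_notMem (hi ▸ hn), hxb]
      simp
    · rw [hbary_out t x hx, hxb, zero_div]
  let R : Set (unitInterval × Realization K) := {p | mass p.2.1 ≤ p.1 / 2}
  have hR1 : ∀ p : R, 0 < 1 - mass p.1.2.1 := fun p => by
    have := p.2
    simp only [R, Set.mem_ofPred_eq] at this
    linarith [p.1.1.2.2]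
  let ret : R → Realization L := fun p =>
    Realization.mk hL (fun b => core p.1.2.1 b / (1 - mass p.1.2.1))
      (fun b => div_nonneg (hcore_nonneg _ b) (hR1 p).le)
      (hL (fun b hb => mem_supp.2 fun h0 => mem_supp.1 hb (by rw [h0, zero_div]))
        (hcore_supp p.1.2))
      (by rw [← Finset.sum_div, hcore_sum, div_self (hR1 p).ne'])
  have hret : Continuous ret := by
    refine Continuous.subtype_mk (continuous_pi fun b => ?_) _
    exact Continuous.div (((continuous_apply b).comp hcore_cont).comp continuous_subtype_val)
      (continuous_const.sub (hmass_cont.comp continuous_subtype_val)) fun p => (hR1 p).ne'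
  let time : R → unitInterval := fun p => ⟨p.1.1 - 2 * mass p.1.2.1, by
    have := p.2
    simp only [R, Set.mem_ofPred_eq] at this
    constructor <;> linarith [hmass_nonneg p.1.2, p.1.1.2.2]⟩
  have htime : Continuous time :=
    Continuous.subtype_mk (by
      refine Continuous.sub (by fun_prop) (continuous_const.mul ?_)
      exact hmass_cont.comp continuous_subtype_val) _
  let low : R → Realization K := fun p => Realization.inclusion hLK (h (time p, ret p))
  have hlow : Continuous low :=
    (Realization.inclusion hLK).continuous.comp (h.continuous.comp (htime.prodMk hret))
  have hlow_supp : ∀ p, supp (low p).1 ∉ Set.range F := fun p =>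
    ((h (time p, ret p)).supp_mem hL).2
  let high : unitInterval × Realization K → α → ℝ := fun p => bary p.1 p.2.1
  let Φ : unitInterval × Realization K → Realization K := fun p =>
    if hp : p ∈ R then low ⟨p, hp⟩ else Realization.mk hK (bary p.1 p.2.1)
      (hbary_nonneg p.1 p.2) (hbary_supp p.1 p.2) (hbary_sum p.1 p.2 (not_le.1 hp).le)
  have hΦR : ∀ p (hp : p ∈ R), Φ p = low ⟨p, hp⟩ := fun p hp => dif_pos hp
  have hΦhigh : ∀ p, (p.1 : ℝ) / 2 ≤ mass p.2.1 → (Φ p).1 = high p := by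
    intro p hle
    by_cases hp : p ∈ R
    · rw [hΦR p hp]
      have heq : mass p.2.1 = p.1 / 2 := le_antisymm hp hle
      have htm : time ⟨p, hp⟩ = 0 := Subtype.ext (by
        change (p.1 : ℝ) - 2 * mass p.2.1 = 0
        rw [heq]; ring)
      have hlow0 : (low ⟨p, hp⟩).1 = (ret ⟨p, hp⟩).1 := by
        simp only [low, htm]
        change (h (0, ret ⟨p, hp⟩)).1 = _
        rw [h.apply_zero]
        rfl
      rw [hlow0]
      funext b
      change core p.2.1 b / (1 - mass p.2.1) = bary p.1 p.2.1 b
      rw [heq]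
      by_cases hx : supp p.2.1 ∈ Set.range F
      · obtain ⟨i, hi⟩ := hx
        have hz : minCoord (F i) p.2.1 - p.1 / 2 / (F i).card = 0 := by
          rw [hmass_in p.2 i hi.symm] at heq
          rw [← heq, mul_div_cancel_left₀ _ (hcard i).ne', sub_self]
        rw [hbary_in p.1 p.2 i hi.symm, hz, max_self, zero_mul, add_zero]
      · rw [hbary_out p.1 p.2 hx, hcore_out p.2 hx]
    · simp only [Φ, dif_neg hp]
      rfl
  have hΦ : Continuous Φ := by
    have hRc : IsClosed R := isClosed_le hmass_cont (by fun_prop)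
    have hTc : IsClosed {p : unitInterval × Realization K | (p.1 : ℝ) / 2 ≤ mass p.2.1} :=
      isClosed_le (by fun_prop) hmass_cont
    have hun : R ∪ {p : unitInterval × Realization K | (p.1 : ℝ) / 2 ≤ mass p.2.1} = Set.univ :=
      Set.eq_univ_of_forall fun p => le_total (mass p.2.1) ((p.1 : ℝ) / 2)
    rw [← continuousOn_univ, ← hun]
    refine ContinuousOn.union_of_isClosed ?_ ?_ hRc hTc
    · rw [continuousOn_iff_continuous_domRestrict]
      convert hlow using 1
      exact funext fun p => hΦR p.1 p.2
    · have : ContinuousOn (fun p => (Φ p).1)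
          {p : unitInterval × Realization K | (p.1 : ℝ) / 2 ≤ mass p.2.1} :=
        hbary_cont.continuousOn.congr hΦhigh
      exact Topology.IsInducing.subtypeVal.continuousOn_iff.2 this
  have hout_mem : ∀ (t : unitInterval) (x : Realization K), supp x.1 ∉ Set.range F →
      (t, x) ∈ R := by
    intro t x hx
    change mass x.1 ≤ t / 2
    rw [hmass_out x hx]
    linarith [t.2.1]
  refine ⟨⟨Φ, hΦ⟩, Realization.inclusion hLK a₀, fun x => ?_, (a₀.supp_mem hL).2,
    fun t x hx => ?_, fun x hx => ?_⟩
  · refine Subtype.ext ?_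
    change (Φ (0, x)).1 = x.1
    rw [hΦhigh _ (by simpa using hmass_nonneg x)]
    funext b
    simp only [high]
    by_cases hx : supp x.1 ∈ Set.range F
    · obtain ⟨i, hi⟩ := hx
      rw [hbary_in 0 x i hi.symm, hcore_in x i hi.symm]
      simp [(hin x i hi.symm).1.le]
    · rw [hbary_out 0 x hx]
      simp
  · change supp (Φ (t, x)).1 ∉ _
    rw [hΦR _ (hout_mem t x hx)]
    exact hlow_supp _
  · change Φ (1, x) = _
    rw [hΦR _ (hout_mem 1 x hx)]
    have htm : time ⟨(1, x), hout_mem 1 x hx⟩ = 1 := Subtype.ext (by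
      change (1 : ℝ) - 2 * mass x.1 = 1
      rw [hmass_out x hx]; ring)
    simp only [low, htm]
    rw [h.apply_one]
    rfl

/-- If the complement of a family of facets is contractible, then the complex is homotopy
equivalent to a wedge of spheres, one for each facet of the family. -/
theorem Realization.nonempty_homotopyEquiv_wedgeOfSpheres {ι : Type*} [Fintype ι]
    {K : Set (Finset α)} (hK : IsLowerSet K) (d : ι → ℕ) (F : ι → Finset α)
    (hcard : ∀ i, (F i).card = d i + 1)
    (hinj : Function.Injective F) (hF : ∀ i, F i ∈ K) (hmax : ∀ i, ∀ s ∈ K, F i ⊆ s → s = F i)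
    (hnull : (ContinuousMap.id (Realization (K \ Set.range F))).Nullhomotopic) :
    Nonempty (ContinuousMap.HomotopyEquiv (Realization K) (WedgeOfSpheres d)) := by
  classical
  have hg : ∀ i, ∃ g : Fin (d i + 1) ↪ α, Finset.univ.map g = F i := fun i => by
    let e := ((F i).equivFinOfCardEq (hcard i)).symm
    refine ⟨e.toEmbedding.trans (Function.Embedding.subtype _), ?_⟩
    ext a
    simp only [Finset.mem_map, Finset.mem_univ, true_and]
    constructor
    · rintro ⟨j, rfl⟩
      exact (e j).2
    · intro ha
      exact ⟨e.symm ⟨a, ha⟩, by simp⟩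
  choose g hg using hg
  have hne : ∀ i, (F i).Nonempty := fun i => Finset.card_pos.1 (by rw [hcard]; omega)
  obtain ⟨Φ, a, h0, ha, hA, h1⟩ :=
    Realization.exists_homotopy_extension hK F hne hinj hF hmax hnull
  choose c hc hpt hci hcs using fun i =>
    exists_facet_collapse hK (g i) (hg i ▸ hF i) (by rw [hg i]; exact hmax i)
  have hsupp : ∀ i x, c i x ≠ SphereD.pt (d i) ↔ supp x.1 = F i := by
    intro i x
    rw [hpt]
    constructor
    · intro hpos
      refine hmax i _ (x.supp_mem hK) fun b hb => ?_
      rw [← hg i] at hb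
      obtain ⟨j, -, rfl⟩ := Finset.mem_map.1 hb
      exact mem_supp.2 (hpos j).ne'
    · intro hx j
      have : g i j ∈ supp x.1 := by
        rw [hx, ← hg i]
        exact Finset.mem_map_of_mem _ (Finset.mem_univ j)
      exact lt_of_le_of_ne (x.2.1 _) (mem_supp.1 this).symm
  have hall : ∀ x, (∀ i, c i x = SphereD.pt (d i)) ↔ supp x.1 ∉ Set.range F := by
    intro x
    simp only [Set.mem_range, not_exists]
    refine forall_congr' fun i => ?_
    rw [← not_iff_not, not_not, eq_comm (a := F i)]
    exact hsupp i x
  have := Realization.compactSpace hK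
  refine nonempty_homotopyEquiv_pwedge (fun i => SphereD.pt (d i)) c hc (fun i v => ?_) hci
    (fun i j x hi hj => hinj (((hsupp i x).1 hi).symm.trans ((hsupp j x).1 hj))) Φ h0
    (fun t x hx => (hall _).2 (hA t x ((hall x).1 hx))) a ((hall a).2 ha)
    fun x hx => h1 x ((hall x).1 hx)
  by_cases hv : v = SphereD.pt (d i)
  · exact ⟨a, hv ▸ (hall a).2 ha i⟩
  · exact hcs i v hv

end FacetExtension

section Matchings

variable {α : Type*} {n : ℕ}

/-- The sets of elements of `E` covering pairwise disjoint subsets of `Fin n`. -/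
def disjointFamilies (E : Set α) (cov : α → Finset (Fin n)) : Set (Finset α) :=
  {s | (∀ e ∈ s, e ∈ E) ∧ ∀ e ∈ s, ∀ f ∈ s, ∀ j, j ∈ cov e → j ∈ cov f → e = f}

theorem isLowerSet_disjointFamilies (E : Set α) (cov : α → Finset (Fin n)) :
    IsLowerSet (disjointFamilies E cov) := fun _ _ hts hs =>
  ⟨fun e he => hs.1 e (hts he), fun e he f hf => hs.2 e (hts he) f (hts hf)⟩

/-- The faces for which some index below `i` is covered by nothing but its distinguished
element `a j`. -/
def freeBelow (E : Set α) (cov : α → Finset (Fin n)) (a : Fin n → α) (i : ℕ) : Set (Finset α) :=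
  {s | s ∈ disjointFamilies E cov ∧ ∃ j : Fin n, j.1 < i ∧ ∀ e ∈ s, j ∈ cov e → e = a j}

/-- The faces covering every index by an element which is not distinguished. -/
def fullFaces (E : Set α) (cov : α → Finset (Fin n)) (a : Fin n → α) : Set (Finset α) :=
  {s | s ∈ disjointFamilies E cov ∧ ∀ j, ∃ e ∈ s, j ∈ cov e ∧ e ≠ a j}

variable {E : Set α} {cov : α → Finset (Fin n)} {a : Fin n → α}

theorem isLowerSet_freeBelow (i : ℕ) : IsLowerSet (freeBelow E cov a i) := by
  rintro s t hts ⟨hs, j, hj, hfree⟩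
  exact ⟨isLowerSet_disjointFamilies E cov hts hs, j, hj, fun e he => hfree e (hts he)⟩

theorem freeBelow_mono {i j : ℕ} (h : i ≤ j) : freeBelow E cov a i ⊆ freeBelow E cov a j :=
  fun _ hs => ⟨hs.1, hs.2.imp fun _ hk => ⟨hk.1.trans_le h, hk.2⟩⟩

theorem insert_mem_disjointFamilies [DecidableEq α] (haE : ∀ i, a i ∈ E)
    (hacov : ∀ i, cov (a i) = {i}) {s : Finset α}
    (hs : s ∈ disjointFamilies E cov) {i : Fin n} (hi : ∀ e ∈ s, i ∈ cov e → e = a i) :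
    insert (a i) s ∈ disjointFamilies E cov := by
  refine ⟨fun e he => ?_, fun e he f hf j hje hjf => ?_⟩
  · rcases Finset.mem_insert.1 he with rfl | he
    · exact haE i
    · exact hs.1 e he
  · rcases Finset.mem_insert.1 he with rfl | he <;> rcases Finset.mem_insert.1 hf with rfl | hf
    · rfl
    · rw [hacov, Finset.mem_singleton] at hje
      exact (hi f hf (hje ▸ hjf)).symm
    · rw [hacov, Finset.mem_singleton] at hjf
      exact hi e he (hjf ▸ hje)
    · exact hs.2 e he f hf j hje hjf

theorem nullhomotopic_freeBelow [Fintype α] (haE : ∀ i, a i ∈ E)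
    (hacov : ∀ i, cov (a i) = {i})
    {i : ℕ} (hi : 1 ≤ i) (hin : i ≤ n) :
    (Realization.inclusion (freeBelow_mono (E := E) (cov := cov) (a := a) hin)).Nullhomotopic := by
  classical
  induction i, hi using Nat.le_induction with
  | base =>
    have h0 : 0 < n := hin
    have hfree : ∀ s ∈ freeBelow E cov a 1, ∀ e ∈ s, (⟨0, h0⟩ : Fin n) ∈ cov e → e = a ⟨0, h0⟩ := by
      rintro s ⟨-, j, hj, hfree⟩
      obtain rfl : j = ⟨0, h0⟩ := Fin.ext (by simpa using hj)
      exact hfree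
    refine (Realization.nullhomotopic_inclusion_of_cone (isLowerSet_freeBelow 1) (a ⟨0, h0⟩)
      ⟨∅, ?_⟩ fun s hs => ⟨insert (a ⟨0, h0⟩) s, ⟨?_, ⟨0, h0⟩, Nat.one_pos, fun e he h => ?_⟩,
        Finset.mem_insert_self _ _, Finset.subset_insert _ _⟩).comp_right
      (Realization.inclusion (freeBelow_mono hin))
    · exact ⟨⟨by simp, by simp⟩, ⟨0, h0⟩, Nat.one_pos, by simp⟩
    · exact insert_mem_disjointFamilies haE hacov hs.1 (hfree s hs)
    · rcases Finset.mem_insert.1 he with rfl | he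
      · rfl
      · exact hfree s hs e he h
  | succ i hi ih =>
    let v : Fin n := ⟨i, hin⟩
    let C : Finset (Finset α) := Finset.univ.filter fun P => P ∈ disjointFamilies E cov ∧
      (∀ e ∈ P, (∃ j ∈ cov e, j.1 < i) ∧ v ∉ cov e) ∧
      ∀ j : Fin n, j.1 < i → ∃ e ∈ P, j ∈ cov e ∧ e ≠ a j
    have hC : ∀ P, P ∈ C ↔ P ∈ disjointFamilies E cov ∧
        (∀ e ∈ P, (∃ j ∈ cov e, j.1 < i) ∧ v ∉ cov e) ∧
        ∀ j : Fin n, j.1 < i → ∃ e ∈ P, j ∈ cov e ∧ e ≠ a j := fun P => by simp [C]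
    have hfree : ∀ s ∈ freeBelow E cov a (i + 1), ∀ P ∈ C, P ⊆ s →
        ∀ e ∈ s, v ∈ cov e → e = a v := by
      rintro s ⟨-, j, hj, hfree⟩ P hP hPs
      rcases Nat.lt_succ_iff_lt_or_eq.1 hj with hj | hj
      · obtain ⟨e, he, hje, hne⟩ := ((hC P).1 hP).2.2 j hj
        exact absurd (hfree e (hPs he) hje) hne
      · obtain rfl : j = v := Fin.ext hj
        exact hfree
    have hmem : ∀ s ∈ freeBelow E cov a (i + 1), ∀ P ∈ C, P ⊆ s →
        ∀ e, e ∈ P ↔ e ∈ s ∧ ∃ j ∈ cov e, j.1 < i := by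
      refine fun s hs P hP hPs e => ⟨fun he => ⟨hPs he, (((hC P).1 hP).2.1 e he).1⟩, ?_⟩
      rintro ⟨he, j, hje, hj⟩
      obtain ⟨f, hf, hjf, -⟩ := ((hC P).1 hP).2.2 j hj
      exact hs.1.2 e he f (hPs hf) j hje hjf ▸ hf
    refine Realization.nullhomotopic_inclusion_of_collapse (isLowerSet_freeBelow _)
      (isLowerSet_freeBelow i) (freeBelow_mono hin) (freeBelow_mono (Nat.le_of_succ_le hin))
      (freeBelow_mono (Nat.le_succ i)) C (a v) ?_ ?_ ?_ ?_ ?_ ?_ (ih (Nat.le_of_succ_le hin))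
    · intro P hP
      obtain ⟨e, he, -⟩ := ((hC P).1 hP).2.2 ⟨0, by omega⟩ hi
      exact ⟨e, he⟩
    · intro P hP haP
      exact (((hC P).1 hP).2.1 _ haP).2 (by simp [hacov])
    · intro s hs P hP Q hQ hPs hQs
      ext e
      rw [hmem s hs P hP hPs, hmem s hs Q hQ hQs]
    · intro s hs P hP hPs
      have hf := hfree s hs P hP hPs
      refine ⟨insert_mem_disjointFamilies haE hacov hs.1 hf, v, Nat.lt_succ_self i,
        fun e he h => ?_⟩
      rcases Finset.mem_insert.1 he with rfl | he
      · rfl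
      · exact hf e he h
    · intro s hs P hP hPs p hp
      have hf := hfree s hs P hP hPs
      refine ⟨isLowerSet_disjointFamilies E cov (Finset.erase_subset _ _)
        (insert_mem_disjointFamilies haE hacov hs.1 hf), ?_⟩
      obtain ⟨j, hjp, hj⟩ := (((hC P).1 hP).2.1 p hp).1
      refine ⟨j, hj, fun e he hje => ?_⟩
      obtain ⟨hep, he⟩ := Finset.mem_erase.1 he
      rcases Finset.mem_insert.1 he with rfl | he
      · rw [hacov, Finset.mem_singleton] at hje
        subst hje
        exact absurd hj (lt_irrefl i)
      · exact absurd (hs.1.2 e he p (hPs hp) j hje hjp) hep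
    · intro s hs hs'
      have hnf : ∀ j : Fin n, j.1 < i → ∃ e ∈ s, j ∈ cov e ∧ e ≠ a j := by
        intro j hj
        by_contra hn
        push Not at hn
        exact hs' ⟨hs.1, j, hj, hn⟩
      have hv : ∀ e ∈ s, v ∈ cov e → e = a v := by
        obtain ⟨-, j, hj, hfree⟩ := hs
        rcases Nat.lt_succ_iff_lt_or_eq.1 hj with hj | hj
        · obtain ⟨e, he, hje, hne⟩ := hnf j hj
          exact absurd (hfree e he hje) hne
        · obtain rfl : j = v := Fin.ext hj
          exact hfree
      refine ⟨s.filter fun e => ∃ j ∈ cov e, j.1 < i, (hC _).2 ⟨?_, ?_, ?_⟩,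
        Finset.filter_subset _ _⟩
      · exact isLowerSet_disjointFamilies E cov (Finset.filter_subset _ _) hs.1
      · intro e he
        obtain ⟨he, j, hje, hj⟩ := Finset.mem_filter.1 he
        refine ⟨⟨j, hje, hj⟩, fun hve => ?_⟩
        rw [hv e he hve, hacov, Finset.mem_singleton] at hje
        subst hje
        exact absurd hj (lt_irrefl i)
      · intro j hj
        obtain ⟨e, he, hje, hne⟩ := hnf j hj
        exact ⟨e, Finset.mem_filter.2 ⟨he, j, hje, hj⟩, hje, hne⟩

/-- The complex of disjoint families is a wedge of spheres indexed by the full faces. -/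
theorem nonempty_homotopyEquiv_of_fullFaces [Fintype α] (hn : 1 ≤ n) (haE : ∀ i, a i ∈ E)
    (hacov : ∀ i, cov (a i) = {i}) (hE : ∀ e ∈ E, (cov e).Nonempty)
    {ι : Type*} [Fintype ι] (d : ι → ℕ) (F : ι → Finset α) (hinj : Function.Injective F)
    (hrange : Set.range F = fullFaces E cov a) (hcard : ∀ i, (F i).card = d i + 1) :
    Nonempty (ContinuousMap.HomotopyEquiv (Realization (disjointFamilies E cov))
      (WedgeOfSpheres d)) := by
  have hfull : ∀ i, F i ∈ fullFaces E cov a := fun i => hrange ▸ Set.mem_range_self i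
  refine Realization.nonempty_homotopyEquiv_wedgeOfSpheres (isLowerSet_disjointFamilies E cov) d F
    hcard hinj (fun i => (hfull i).1) (fun i s hs his => ?_) ?_
  · refine Finset.Subset.antisymm (fun e he => ?_) his
    obtain ⟨j, hj⟩ := hE e (hs.1 e he)
    obtain ⟨f, hf, hjf, -⟩ := (hfull i).2 j
    exact hs.2 e he f (his hf) j hj hjf ▸ hf
  · have heq : disjointFamilies E cov \ Set.range F = freeBelow E cov a n := by
      ext s
      rw [hrange]
      simp only [fullFaces, freeBelow, Set.mem_sdiff, Set.mem_ofPred_eq, not_and]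
      refine and_congr_right fun hs => ⟨fun h => ?_, ?_⟩
      · have h := h hs
        push Not at h
        obtain ⟨j, hj⟩ := h
        exact ⟨j, j.2, hj⟩
      · rintro ⟨j, -, hj⟩ - hall
        obtain ⟨e, he, hje, hne⟩ := hall j
        exact hne (hj e he hje)
    rw [heq]
    exact nullhomotopic_freeBelow haE hacov hn le_rfl

end Matchings

section Tilings

theorem biUnion_blocks_injOn_of_gaps {P Q : Finset ℕ}
    (hP : ∀ j ∈ P, ∀ l ∈ P, j ≠ l → j + 2 ≤ l ∨ l + 2 ≤ j)
    (hQ : ∀ j ∈ Q, ∀ l ∈ Q, j ≠ l → j + 2 ≤ l ∨ l + 2 ≤ j)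
    (h : (P.biUnion fun j => {j, j + 1}) = Q.biUnion fun j => {j, j + 1}) : P = Q := by
  have hmem : ∀ i, (∃ p ∈ P, i = p ∨ i = p + 1) ↔ ∃ p ∈ Q, i = p ∨ i = p + 1 := fun i => by
    simpa using Finset.ext_iff.1 h i
  ext j
  induction j using Nat.strong_induction_on with
  | _ j ih =>
    constructor
    · intro hj
      obtain ⟨q, hq, rfl | rfl⟩ := (hmem j).1 ⟨j, hj, Or.inl rfl⟩
      · exact hq
      · have := hP _ ((ih q (by omega)).2 hq) _ hj (by omega)
        omega
    · intro hj
      obtain ⟨q, hq, rfl | rfl⟩ := (hmem j).2 ⟨j, hj, Or.inl rfl⟩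
      · exact hq
      · have := hQ _ ((ih q (by omega)).1 hq) _ hj (by omega)
        omega

theorem card_biUnion_blocks {P : Finset ℕ}
    (hP : ∀ j ∈ P, ∀ l ∈ P, j ≠ l → j + 2 ≤ l ∨ l + 2 ≤ j) :
    (P.biUnion fun j => {j, j + 1}).card = 2 * P.card := by
  rw [Finset.card_biUnion, Finset.sum_const_nat (m := 2), mul_comm]
  · intro j _
    exact Finset.card_pair (by omega)
  · intro j hj l hl hne
    have := hP j hj l hl hne
    rw [Function.onFun, Finset.disjoint_left]
    intro x hx hx'
    simp only [Finset.mem_insert, Finset.mem_singleton] at hx hx'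
    omega

end Tilings

section Caterpillar

variable {n : ℕ} {m : Fin n → ℕ}

/-- The edge of the central path following the `i`-th vertex (a loop at the last vertex). -/
def spineEdge (m : Fin n → ℕ) (i : Fin n) : Sym2 (Fin n ⊕ Σ i : Fin n, Fin (m i)) :=
  s(Sum.inl i, Sum.inl (if h : i.1 + 1 < n then ⟨i.1 + 1, h⟩ else i))

/-- The `c`-th leg at the `i`-th vertex of the central path. -/
def legEdge (i : Fin n) (c : Fin (m i)) : Sym2 (Fin n ⊕ Σ i : Fin n, Fin (m i)) :=
  s(Sum.inl i, Sum.inr ⟨i, c⟩)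

open Classical in
/-- The vertices of the central path on an edge. -/
noncomputable def spineVertices (e : Sym2 (Fin n ⊕ Σ i : Fin n, Fin (m i))) : Finset (Fin n) :=
  Finset.univ.filter fun i => Sum.inl i ∈ e

theorem mem_spineVertices {e : Sym2 (Fin n ⊕ Σ i : Fin n, Fin (m i))} {i : Fin n} :
    i ∈ spineVertices e ↔ Sum.inl i ∈ e := by
  simp [spineVertices]

theorem mem_spineVertices_legEdge {i j : Fin n} {c : Fin (m i)} :
    j ∈ spineVertices (legEdge i c) ↔ j = i := by
  simp [mem_spineVertices, legEdge]

theorem mem_spineVertices_spineEdge {i j : Fin n} (hi : i.1 + 1 < n) :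
    j ∈ spineVertices (spineEdge m i) ↔ j = i ∨ j.1 = i.1 + 1 := by
  simp [mem_spineVertices, spineEdge, hi, Fin.ext_iff]

theorem legEdge_ne_spineEdge {i j : Fin n} {c : Fin (m i)} : legEdge i c ≠ spineEdge m j := by
  simp [legEdge, spineEdge]

theorem legEdge_injective (i : Fin n) : Function.Injective (legEdge (m := m) i) := by
  intro c d h
  simpa [legEdge] using h

theorem eq_of_legEdge_eq {i j : Fin n} {c : Fin (m i)} {d : Fin (m j)}
    (h : legEdge i c = legEdge j d) : i = j := by
  have := (mem_spineVertices_legEdge (c := c)).2 (rfl : i = i)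
  rw [h] at this
  exact mem_spineVertices_legEdge.1 this

theorem spineEdge_injOn : Set.InjOn (spineEdge m) {i | i.1 + 1 < n} := by
  intro i hi j hj h
  have h₁ := (mem_spineVertices_spineEdge (m := m) hi).2 (Or.inl (rfl : i = i))
  have h₂ := (mem_spineVertices_spineEdge (m := m) hj).2 (Or.inl (rfl : j = j))
  rw [h, mem_spineVertices_spineEdge hj] at h₁
  rw [← h, mem_spineVertices_spineEdge hi] at h₂
  rw [Fin.ext_iff] at *
  omega

theorem mem_edgeSet_caterpillar {e : Sym2 (Fin n ⊕ Σ i : Fin n, Fin (m i))} :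
    e ∈ (caterpillar n m).edgeSet ↔
      (∃ i : Fin n, i.1 + 1 < n ∧ e = spineEdge m i) ∨ ∃ i c, e = legEdge (m := m) i c := by
  constructor
  · induction e using Sym2.ind with
    | _ p q =>
      rw [SimpleGraph.mem_edgeSet, caterpillar, SimpleGraph.fromRel_adj]
      have key : ∀ i j : Fin n, i.1 + 1 = j.1 → i.1 + 1 < n ∧ s(Sum.inl i, Sum.inl j) =
          spineEdge m i := by
        intro i j h
        have hi : i.1 + 1 < n := h ▸ j.2
        refine ⟨hi, ?_⟩
        have : j = ⟨i.1 + 1, hi⟩ := Fin.ext h.symm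
        simp [spineEdge, hi, this]
      rcases p with i | ⟨i, c⟩ <;> rcases q with j | ⟨j, d⟩
      · rintro ⟨-, h | h⟩
        · exact Or.inl ⟨i, key i j h⟩
        · rw [Sym2.eq_swap]
          exact Or.inl ⟨j, key j i h⟩
      · rintro ⟨-, h | h⟩
        · obtain rfl : i = j := h
          exact Or.inr ⟨i, d, rfl⟩
        · exact h.elim
      · rintro ⟨-, h | h⟩
        · exact h.elim
        · obtain rfl : j = i := h
          exact Or.inr ⟨j, c, Sym2.eq_swap⟩
      · rintro ⟨-, h | h⟩ <;> exact h.elim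
  · rintro (⟨i, hi, rfl⟩ | ⟨i, c, rfl⟩)
    · simp [spineEdge, hi, caterpillar, Fin.ext_iff]
    · simp [legEdge, caterpillar]

theorem matchingComplex_caterpillar_eq_disjointFamilies :
    matchingComplex (caterpillar n m) =
      disjointFamilies (caterpillar n m).edgeSet spineVertices := by
  ext s
  refine and_congr_right fun hs => ⟨fun h e he f hf j hje hjf => ?_, fun h e he f hf hne => ?_⟩
  · by_contra hne
    exact h he hf hne ⟨_, mem_spineVertices.1 hje, mem_spineVertices.1 hjf⟩
  · rintro ⟨v, hve, hvf⟩
    rcases v with j | ⟨i, c⟩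
    · exact hne (h e he f hf j (mem_spineVertices.2 hve) (mem_spineVertices.2 hvf))
    · have key : ∀ e ∈ s, Sum.inr ⟨i, c⟩ ∈ e → e = legEdge i c := by
        intro e he hce
        rcases mem_edgeSet_caterpillar.1 (hs e he) with ⟨j, hj, rfl⟩ | ⟨j, d, rfl⟩
        · simp [spineEdge] at hce
        · simp only [legEdge, Sym2.mem_iff, reduceCtorEq, false_or, Sum.inr.injEq] at hce
          cases hce
          rfl
      exact hne ((key e he hve).trans (key f hf hvf).symm)

/-- The positions, counted from `1`, carrying a nonzero label. -/
def labelSupport (f : ∀ i, Fin (m i)) : Finset ℕ :=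
  (Finset.univ.filter fun i => (f i).1 ≠ 0).image fun i : Fin n => i.1 + 1

theorem succ_mem_labelSupport {f : ∀ i, Fin (m i)} {i : Fin n} :
    i.1 + 1 ∈ labelSupport f ↔ (f i).1 ≠ 0 := by
  simp [labelSupport, Fin.val_inj]

theorem labelSupport_subset (f : ∀ i, Fin (m i)) : labelSupport f ⊆ Finset.Icc 1 n := by
  intro i hi
  simp only [labelSupport, Finset.mem_image] at hi
  obtain ⟨j, -, rfl⟩ := hi
  have := j.2
  simp only [Finset.mem_Icc]
  omega

/-- The set `P` of first positions of blocks tiles the positions labelled `0`. -/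
def IsLabelTiling (f : ∀ i, Fin (m i)) (P : Finset ℕ) : Prop :=
  (∀ j ∈ P, ∀ l ∈ P, j ≠ l → j + 2 ≤ l ∨ l + 2 ≤ j) ∧
    Finset.Icc 1 n \ labelSupport f = P.biUnion fun j => {j, j + 1}

theorem isLabelTiling_iff {f : ∀ i, Fin (m i)} {P : Finset ℕ} : IsLabelTiling f P ↔
    (∀ j ∈ P, ∀ l ∈ P, j ≠ l → j + 2 ≤ l ∨ l + 2 ≤ j) ∧ (∀ j ∈ P, 1 ≤ j ∧ j + 1 ≤ n) ∧
      ∀ i : Fin n, (f i).1 = 0 ↔ i.1 + 1 ∈ P ∨ i.1 ∈ P := by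
  refine and_congr_right fun hP => ⟨fun h => ?_, fun ⟨h₁, h₂⟩ => ?_⟩
  · have hmem : ∀ i, (i ∈ Finset.Icc 1 n ∧ i ∉ labelSupport f) ↔ ∃ p ∈ P, i = p ∨ i = p + 1 :=
      fun i => by simpa using Finset.ext_iff.1 h i
    refine ⟨fun j hj => ⟨?_, ?_⟩, fun i => ?_⟩
    · exact (Finset.mem_Icc.1 ((hmem j).2 ⟨j, hj, Or.inl rfl⟩).1).1
    · exact (Finset.mem_Icc.1 ((hmem (j + 1)).2 ⟨j, hj, Or.inr rfl⟩).1).2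
    · have := hmem (i.1 + 1)
      rw [succ_mem_labelSupport, not_not, Finset.mem_Icc] at this
      constructor
      · intro h0
        obtain ⟨p, hp, hip | hip⟩ := this.1 ⟨⟨by omega, i.2⟩, h0⟩
        · exact Or.inl (hip ▸ hp)
        · exact Or.inr ((by omega : i.1 = p) ▸ hp)
      · rintro (hi | hi)
        · exact (this.2 ⟨_, hi, Or.inl rfl⟩).2
        · exact (this.2 ⟨_, hi, Or.inr rfl⟩).2
  · ext i
    simp only [Finset.mem_sdiff, Finset.mem_biUnion, Finset.mem_insert, Finset.mem_singleton]
    constructor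
    · rintro ⟨hi, hif⟩
      rw [Finset.mem_Icc] at hi
      obtain ⟨j, rfl⟩ : ∃ j : Fin n, j.1 + 1 = i := ⟨⟨i - 1, by omega⟩, by simp; omega⟩
      rw [succ_mem_labelSupport, not_not, h₂] at hif
      exact hif.elim (fun h => ⟨_, h, Or.inl rfl⟩) fun h => ⟨_, h, Or.inr rfl⟩
    · rintro ⟨p, hp, rfl | rfl⟩
      · have := h₁ i hp
        obtain ⟨j, rfl⟩ : ∃ j : Fin n, j.1 + 1 = i := ⟨⟨i - 1, by omega⟩, by simp; omega⟩
        refine ⟨Finset.mem_Icc.2 (by omega), ?_⟩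
        rw [succ_mem_labelSupport, not_not, h₂]
        exact Or.inl hp
      · have := h₁ p hp
        refine ⟨Finset.mem_Icc.2 (by omega), ?_⟩
        have := succ_mem_labelSupport (f := f) (i := ⟨p, this.2⟩)
        rw [this, not_not, h₂]
        exact Or.inr hp

open Classical in
/-- The matching given by the legs with nonzero labels and the path edges starting at the
positions in `P`. -/
noncomputable def labelledMatching (f : ∀ i, Fin (m i)) (P : Finset ℕ) :
    Finset (Sym2 (Fin n ⊕ Σ i : Fin n, Fin (m i))) :=
  (Finset.univ.filter fun i : Fin n => i.1 + 1 ∈ P).image (spineEdge m) ∪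
    (Finset.univ.filter fun i => (f i).1 ≠ 0).image fun i => legEdge i (f i)

theorem mem_labelledMatching {f : ∀ i, Fin (m i)} {P : Finset ℕ}
    {e : Sym2 (Fin n ⊕ Σ i : Fin n, Fin (m i))} : e ∈ labelledMatching f P ↔
      (∃ i : Fin n, i.1 + 1 ∈ P ∧ spineEdge m i = e) ∨
        ∃ i, (f i).1 ≠ 0 ∧ legEdge i (f i) = e := by
  simp [labelledMatching]

theorem legEdge_mem_labelledMatching {f : ∀ i, Fin (m i)} {P : Finset ℕ} {i : Fin n}
    {c : Fin (m i)} : legEdge i c ∈ labelledMatching f P ↔ c.1 ≠ 0 ∧ f i = c := by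
  rw [mem_labelledMatching]
  constructor
  · rintro (⟨j, -, h⟩ | ⟨j, hj, h⟩)
    · exact (legEdge_ne_spineEdge h.symm).elim
    · obtain rfl := eq_of_legEdge_eq h
      obtain rfl := legEdge_injective _ h
      exact ⟨hj, rfl⟩
  · rintro ⟨h, rfl⟩
    exact Or.inr ⟨i, h, rfl⟩

theorem labelledMatching_left_injective {f g : ∀ i, Fin (m i)} {P Q : Finset ℕ}
    (h : labelledMatching f P = labelledMatching g Q) : f = g := by
  funext i
  by_cases hf : (f i).1 = 0
  · by_cases hg : (g i).1 = 0
    · exact Fin.ext (hf.trans hg.symm)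
    · have := (legEdge_mem_labelledMatching (f := g) (P := Q)).2 ⟨hg, rfl⟩
      rw [← h] at this
      exact (legEdge_mem_labelledMatching.1 this).2
  · have := (legEdge_mem_labelledMatching (f := f) (P := P)).2 ⟨hf, rfl⟩
    rw [h] at this
    exact (legEdge_mem_labelledMatching.1 this).2.symm

theorem labelledMatching_mem_fullFaces (hm : ∀ i, 1 ≤ m i) {f : ∀ i, Fin (m i)} {P : Finset ℕ}
    (h : IsLabelTiling f P) : labelledMatching f P ∈
      fullFaces (caterpillar n m).edgeSet spineVertices fun i => legEdge i ⟨0, hm i⟩ := by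
  obtain ⟨hgap, hP, hf⟩ := isLabelTiling_iff.1 h
  refine ⟨⟨fun e he => ?_, fun e he e' he' j hj hj' => ?_⟩, fun j => ?_⟩
  · rw [mem_edgeSet_caterpillar]
    rcases mem_labelledMatching.1 he with ⟨i, hi, rfl⟩ | ⟨i, hi, rfl⟩
    · exact Or.inl ⟨i, (hP _ hi).2, rfl⟩
    · exact Or.inr ⟨i, _, rfl⟩
  · rcases mem_labelledMatching.1 he with ⟨i, hi, rfl⟩ | ⟨i, hi, rfl⟩ <;>
      rcases mem_labelledMatching.1 he' with ⟨i', hi', rfl⟩ | ⟨i', hi', rfl⟩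
    · rw [mem_spineVertices_spineEdge (hP _ hi).2, Fin.ext_iff] at hj
      rw [mem_spineVertices_spineEdge (hP _ hi').2, Fin.ext_iff] at hj'
      congr 1
      by_contra hne
      rw [Fin.ext_iff] at hne
      have := hgap _ hi _ hi' (by omega)
      omega
    · rw [mem_spineVertices_spineEdge (hP _ hi).2] at hj
      rw [mem_spineVertices_legEdge] at hj'
      subst hj'
      refine absurd ((hf j).2 ?_) hi'
      rcases hj with rfl | hj
      · exact Or.inl hi
      · exact Or.inr (hj ▸ hi)
    · rw [mem_spineVertices_spineEdge (hP _ hi').2] at hj'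
      rw [mem_spineVertices_legEdge] at hj
      subst hj
      refine absurd ((hf j).2 ?_) hi
      rcases hj' with rfl | hj'
      · exact Or.inl hi'
      · exact Or.inr (hj' ▸ hi')
    · rw [mem_spineVertices_legEdge] at hj hj'
      subst hj hj'
      rfl
  · by_cases h0 : (f j).1 = 0
    · rcases (hf j).1 h0 with hj | hj
      · exact ⟨spineEdge m j, mem_labelledMatching.2 (Or.inl ⟨j, hj, rfl⟩),
          (mem_spineVertices_spineEdge (hP _ hj).2).2 (Or.inl rfl), legEdge_ne_spineEdge.symm⟩
      · have := hP _ hj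
        have hj₁ : j.1 - 1 + 1 = j.1 := by omega
        refine ⟨spineEdge m ⟨j.1 - 1, by omega⟩, mem_labelledMatching.2 (Or.inl ⟨_, ?_, rfl⟩),
          (mem_spineVertices_spineEdge ?_).2 (Or.inr ?_), legEdge_ne_spineEdge.symm⟩
        · exact hj₁.symm ▸ hj
        · exact hj₁.symm ▸ j.2
        · exact hj₁.symm
    · refine ⟨legEdge j (f j), legEdge_mem_labelledMatching.2 ⟨h0, rfl⟩,
        mem_spineVertices_legEdge.2 rfl, fun h => h0 ?_⟩
      rw [legEdge_injective j h]

theorem exists_labelledMatching_eq (hm : ∀ i, 1 ≤ m i)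
    {s : Finset (Sym2 (Fin n ⊕ Σ i : Fin n, Fin (m i)))}
    (hs : s ∈ fullFaces (caterpillar n m).edgeSet spineVertices fun i => legEdge i ⟨0, hm i⟩) :
    ∃ f P, IsLabelTiling f P ∧ labelledMatching f P = s := by
  classical
  obtain ⟨⟨hE, hdisj⟩, hfull⟩ := hs
  have hlabel : ∀ i, ∃ c : Fin (m i), ∀ d, (d.1 ≠ 0 ∧ c = d) ↔ legEdge i d ∈ s := by
    intro i
    have hzero : ∀ d, legEdge i d ∈ s → d.1 ≠ 0 := by
      intro d hd h0
      obtain ⟨e, he, hie, hne⟩ := hfull i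
      refine hne ((hdisj e he _ hd i hie (mem_spineVertices_legEdge.2 rfl)).trans ?_)
      exact congrArg _ (Fin.ext h0)
    by_cases h : ∃ c, legEdge i c ∈ s
    · obtain ⟨c, hc⟩ := h
      refine ⟨c, fun d => ⟨?_, fun hd => ⟨hzero d hd, ?_⟩⟩⟩
      · rintro ⟨-, rfl⟩
        exact hc
      · exact legEdge_injective i (hdisj _ hc _ hd i (mem_spineVertices_legEdge.2 rfl)
          (mem_spineVertices_legEdge.2 rfl))
    · refine ⟨⟨0, hm i⟩, fun d => ⟨?_, fun hd => (h ⟨d, hd⟩).elim⟩⟩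
      rintro ⟨h0, rfl⟩
      exact (h0 rfl).elim
  choose f hf using hlabel
  let P : Finset ℕ := (Finset.univ.filter fun i : Fin n => i.1 + 1 < n ∧ spineEdge m i ∈ s).image
    fun i => i.1 + 1
  have hP : ∀ p, p ∈ P ↔ ∃ i : Fin n, (i.1 + 1 < n ∧ spineEdge m i ∈ s) ∧ i.1 + 1 = p := fun p => by
    simp [P]
  have hPs : ∀ i : Fin n, i.1 + 1 ∈ P ↔ i.1 + 1 < n ∧ spineEdge m i ∈ s := by
    intro i
    rw [hP]
    constructor
    · rintro ⟨j, hj, hij⟩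
      obtain rfl : j = i := Fin.ext (by omega)
      exact hj
    · exact fun h => ⟨i, h, rfl⟩
  refine ⟨f, P, isLabelTiling_iff.2 ⟨?_, ?_, ?_⟩, ?_⟩
  · intro j hj l hl hne
    obtain ⟨j, ⟨hjn, hjs⟩, rfl⟩ := (hP j).1 hj
    obtain ⟨l, ⟨hln, hls⟩, rfl⟩ := (hP l).1 hl
    have key : ∀ i i' : Fin n, i.1 + 1 < n → i'.1 + 1 < n → spineEdge m i ∈ s →
        spineEdge m i' ∈ s → i'.1 ≠ i.1 + 1 := by
      intro i i' hin hin' hi hi' h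
      have := spineEdge_injOn hin hin' (hdisj _ hi _ hi' i'
        ((mem_spineVertices_spineEdge hin).2 (Or.inr h))
        ((mem_spineVertices_spineEdge hin').2 (Or.inl rfl)))
      rw [Fin.ext_iff] at this
      omega
    have h₁ := key j l hjn hln hjs hls
    have h₂ := key l j hln hjn hls hjs
    omega
  · intro j hj
    obtain ⟨j, ⟨hjn, hj⟩, rfl⟩ := (hP j).1 hj
    omega
  · intro i
    constructor
    · intro h0
      obtain ⟨e, he, hie, hne⟩ := hfull i
      rcases mem_edgeSet_caterpillar.1 (hE e he) with ⟨j, hj, rfl⟩ | ⟨j, d, rfl⟩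
      · rcases (mem_spineVertices_spineEdge hj).1 hie with rfl | hij
        · exact Or.inl ((hPs i).2 ⟨hj, he⟩)
        · exact Or.inr (hij ▸ (hPs j).2 ⟨hj, he⟩)
      · obtain rfl := mem_spineVertices_legEdge.1 hie
        obtain ⟨hd, rfl⟩ := (hf i d).2 he
        exact (hd h0).elim
    · intro h
      by_contra h0
      have hleg := (hf i (f i)).1 ⟨h0, rfl⟩
      obtain ⟨j, hjn, hj, hij⟩ : ∃ j : Fin n, j.1 + 1 < n ∧ spineEdge m j ∈ s ∧
          (i = j ∨ i.1 = j.1 + 1) := by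
        rcases h with h | h
        · exact ⟨i, ((hPs i).1 h).1, ((hPs i).1 h).2, Or.inl rfl⟩
        · obtain ⟨j, ⟨hjn, hj⟩, hij⟩ := (hP _).1 h
          exact ⟨j, hjn, hj, Or.inr hij.symm⟩
      exact legEdge_ne_spineEdge (hdisj _ hleg _ hj i (mem_spineVertices_legEdge.2 rfl)
        ((mem_spineVertices_spineEdge hjn).2 hij))
  · ext e
    constructor
    · intro he
      rcases mem_labelledMatching.1 he with ⟨i, hi, rfl⟩ | ⟨i, hi, rfl⟩
      · exact ((hPs i).1 hi).2
      · exact (hf i _).1 ⟨hi, rfl⟩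
    · intro he
      rcases mem_edgeSet_caterpillar.1 (hE e he) with ⟨j, hj, rfl⟩ | ⟨j, d, rfl⟩
      · exact mem_labelledMatching.2 (Or.inl ⟨j, (hPs j).2 ⟨hj, he⟩, rfl⟩)
      · exact legEdge_mem_labelledMatching.2 ((hf j d).2 he)

theorem card_labelSupport_add {f : ∀ i, Fin (m i)} {P : Finset ℕ} (h : IsLabelTiling f P) :
    (labelSupport f).card + 2 * P.card = n := by
  rw [← card_biUnion_blocks h.1, ← h.2, add_comm,
    Finset.card_sdiff_add_card_eq_card (labelSupport_subset f), Nat.card_Icc, Nat.add_sub_cancel]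

theorem card_labelledMatching {f : ∀ i, Fin (m i)} {P : Finset ℕ} (h : IsLabelTiling f P) :
    (labelledMatching f P).card = P.card + (labelSupport f).card := by
  classical
  obtain ⟨hgap, hP, hf⟩ := isLabelTiling_iff.1 h
  have hPimage : P = (Finset.univ.filter fun i : Fin n => i.1 + 1 ∈ P).image fun i => i.1 + 1 := by
    ext p
    simp only [Finset.mem_image, Finset.mem_filter, Finset.mem_univ, true_and]
    constructor
    · intro hp
      have := hP p hp
      have hp₁ : p - 1 + 1 = p := by omega
      exact ⟨⟨p - 1, by omega⟩, hp₁.symm ▸ hp, hp₁⟩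
    · rintro ⟨i, hi, rfl⟩
      exact hi
  have hsucc : Function.Injective fun i : Fin n => i.1 + 1 := fun i j hij => Fin.ext (by
    simpa using hij)
  rw [labelledMatching, Finset.card_union_of_disjoint, Finset.card_image_of_injOn,
    Finset.card_image_of_injective, labelSupport, Finset.card_image_of_injective _ hsucc]
  · congr 1
    conv_rhs => rw [hPimage]
    rw [Finset.card_image_of_injective _ hsucc]
  · exact fun i j hij => eq_of_legEdge_eq hij
  · refine spineEdge_injOn.mono fun i hi => ?_
    simp only [Finset.coe_filter, Finset.mem_univ, true_and, Set.mem_ofPred_eq] at hi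
    exact (hP _ hi).2
  · rw [Finset.disjoint_left]
    intro e he he'
    obtain ⟨i, -, rfl⟩ := Finset.mem_image.1 he
    obtain ⟨j, -, hj⟩ := Finset.mem_image.1 he'
    exact legEdge_ne_spineEdge hj

theorem card_filter_labelSupport_eq (hm : ∀ i, 1 ≤ m i) {s : Finset ℕ}
    (hs : s ⊆ Finset.Icc 1 n) :
    (Finset.univ.filter fun f : ∀ i, Fin (m i) => labelSupport f = s).card =
      ∏ i ∈ s, if h : i - 1 < n then m ⟨i - 1, h⟩ - 1 else 0 := by
  have heq : (Finset.univ.filter fun f : ∀ i, Fin (m i) => labelSupport f = s) =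
      Fintype.piFinset fun i => Finset.univ.filter fun c : Fin (m i) =>
        i.1 + 1 ∈ s ↔ c.1 ≠ 0 := by
    ext f
    simp only [Finset.mem_filter, Finset.mem_univ, true_and, Fintype.mem_piFinset]
    constructor
    · rintro rfl i
      exact succ_mem_labelSupport
    · intro h
      ext i
      by_cases hi : i ∈ Finset.Icc 1 n
      · rw [Finset.mem_Icc] at hi
        obtain ⟨j, rfl⟩ : ∃ j : Fin n, j.1 + 1 = i := ⟨⟨i - 1, by omega⟩, by simp; omega⟩
        rw [succ_mem_labelSupport, h]
      · exact iff_of_false (fun h => hi (labelSupport_subset f h)) fun h => hi (hs h)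
  have hcard : ∀ i : Fin n, (Finset.univ.filter fun c : Fin (m i) =>
      i.1 + 1 ∈ s ↔ c.1 ≠ 0).card = if i.1 + 1 ∈ s then m i - 1 else 1 := by
    intro i
    have hzero : (Finset.univ.filter fun c : Fin (m i) => c.1 = 0) = {⟨0, hm i⟩} := by
      ext c
      simp [Fin.ext_iff]
    split_ifs with hi
    · simp only [hi, true_iff]
      have := Finset.card_filter_add_card_filter_not (s := Finset.univ)
        (fun c : Fin (m i) => c.1 = 0)
      rw [hzero, Finset.card_singleton, Finset.card_univ, Fintype.card_fin] at this
      simp only [ne_eq]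
      omega
    · simp only [hi, false_iff, ne_eq, not_not]
      rw [hzero, Finset.card_singleton]
  rw [heq, Fintype.card_piFinset, Finset.prod_congr rfl fun i _ => hcard i, ← Finset.prod_filter]
  refine Finset.prod_bij (fun i _ => i.1 + 1) ?_ ?_ ?_ ?_
  · intro i hi
    exact (Finset.mem_filter.1 hi).2
  · intro i _ j _ hij
    exact Fin.ext (by simpa using hij)
  · intro p hp
    have := Finset.mem_Icc.1 (hs hp)
    have hp₁ : p - 1 + 1 = p := by omega
    exact ⟨⟨p - 1, by omega⟩, by simpa [hp₁] using hp, hp₁⟩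
  · intro i _
    simp

open Classical in
theorem card_pairable_labels (hm : ∀ i, 1 ≤ m i) (x : ℕ) :
    (Finset.univ.filter fun f : ∀ i, Fin (m i) =>
      (labelSupport f).card = x ∧ Pairable (Finset.Icc 1 n \ labelSupport f)).card =
      Msum n x fun i => if h : i - 1 < n then m ⟨i - 1, h⟩ - 1 else 0 := by
  rw [Msum, Finset.card_eq_sum_card_fiberwise (f := labelSupport) (t := markedSets n x)]
  · refine Finset.sum_congr rfl fun s hs => ?_
    simp only [markedSets, Finset.mem_filter, Finset.mem_powerset] at hs
    rw [← card_filter_labelSupport_eq hm hs.1, Finset.filter_filter]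
    congr 1
    refine Finset.filter_congr fun f _ => ⟨fun h => h.2, fun h => ⟨?_, h⟩⟩
    rw [h]
    exact hs.2
  · intro f hf
    simp only [Finset.coe_filter, Finset.mem_univ, true_and, Set.mem_ofPred_eq] at hf
    simp only [markedSets, Finset.coe_filter, Finset.mem_powerset, Set.mem_ofPred_eq]
    exact ⟨labelSupport_subset f, hf⟩

/-- The matching complex of a caterpillar as a wedge of spheres, grouped by the sizes `x ℓ` of
the marked sets, where a marked set of size `x ℓ` gives spheres of dimension `d ℓ`. -/
theorem nonempty_homotopyEquiv_matchingComplex_caterpillar (hn : 1 ≤ n) (hm : ∀ i, 1 ≤ m i)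
    {κ : Type} [Fintype κ] (x d : κ → ℕ) (hx : Function.Injective x)
    (hrange : ∀ y p, y + 2 * p = n → ∃ l, x l = y)
    (hd : ∀ l p, x l + 2 * p = n → p + x l = d l + 1) :
    Nonempty (ContinuousMap.HomotopyEquiv (Realization (matchingComplex (caterpillar n m)))
      (WedgeOfSpheres fun p : Σ l : κ, Fin (Msum n (x l)
        (fun i => if h : i - 1 < n then m ⟨i - 1, h⟩ - 1 else 0)) => d p.1)) := by
  classical
  have hequiv := fun l => Finset.equivFinOfCardEq (card_pairable_labels hm (x l))
  let label := fun p : Σ l : κ, Fin (Msum n (x l)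
    (fun i => if h : i - 1 < n then m ⟨i - 1, h⟩ - 1 else 0)) => ((hequiv p.1).symm p.2).1
  have hlabel : ∀ p, (labelSupport (label p)).card = x p.1 ∧
      ∃ P, IsLabelTiling (label p) P := fun p => by
    have := ((hequiv p.1).symm p.2).2
    simp only [Finset.mem_filter, Finset.mem_univ, true_and] at this
    exact this
  choose hsupp P hP using hlabel
  rw [matchingComplex_caterpillar_eq_disjointFamilies]
  refine nonempty_homotopyEquiv_of_fullFaces (a := fun i => legEdge i ⟨0, hm i⟩) hn
    (fun i => mem_edgeSet_caterpillar.2 (Or.inr ⟨i, _, rfl⟩)) (fun i => ?_) (fun e he => ?_) _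
    (fun p => labelledMatching (label p) (P p)) ?_ ?_ fun p => ?_
  · ext j
    rw [mem_spineVertices_legEdge, Finset.mem_singleton]
  · rcases mem_edgeSet_caterpillar.1 he with ⟨i, hi, rfl⟩ | ⟨i, c, rfl⟩
    · exact ⟨i, (mem_spineVertices_spineEdge hi).2 (Or.inl rfl)⟩
    · exact ⟨i, mem_spineVertices_legEdge.2 rfl⟩
  · intro p q hpq
    have hpq := labelledMatching_left_injective hpq
    have h₁ := (hsupp p).symm.trans ((congrArg (fun f => (labelSupport f).card) hpq).trans (hsupp q))
    obtain ⟨l, p⟩ := p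
    obtain ⟨l', q⟩ := q
    obtain rfl : l = l' := hx h₁
    exact congrArg _ ((hequiv l).symm.injective (Subtype.ext hpq))
  · ext s
    constructor
    · rintro ⟨p, rfl⟩
      exact labelledMatching_mem_fullFaces hm (hP p)
    · intro hs
      obtain ⟨f, Q, hQ, rfl⟩ := exists_labelledMatching_eq hm hs
      obtain ⟨l, hl⟩ := hrange _ _ (card_labelSupport_add hQ)
      have hf : f ∈ Finset.univ.filter fun f : ∀ i, Fin (m i) =>
          (labelSupport f).card = x l ∧ Pairable (Finset.Icc 1 n \ labelSupport f) := by
        simp only [Finset.mem_filter, Finset.mem_univ, true_and]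
        exact ⟨hl.symm, Q, hQ⟩
      have hfl : label ⟨l, hequiv l ⟨f, hf⟩⟩ = f := by simp [label]
      refine ⟨⟨l, hequiv l ⟨f, hf⟩⟩, ?_⟩
      have hP' := hP ⟨l, hequiv l ⟨f, hf⟩⟩
      simp only
      generalize P ⟨l, hequiv l ⟨f, hf⟩⟩ = R at hP' ⊢
      rw [hfl] at hP' ⊢
      rw [biUnion_blocks_injOn_of_gaps hP'.1 hQ.1 (hP'.2.symm.trans hQ.2)]
  · rw [card_labelledMatching (hP p), hsupp]
    exact hd _ _ (hsupp p ▸ card_labelSupport_add (hP p))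

end Caterpillar

/-- Homotopy type of the matching complex of the caterpillar graph
`G_n(m₁, …, m_n)` with `m_i ≥ 1` legs at the `i`-th path vertex, `t_i = m_i − 1`:
for `n = 2k` it is a wedge of `M_{2ℓ}^{2k}(t)` spheres `S^{k−1+ℓ}` over `ℓ = 0,…,k`;
for `n = 2k+1` a wedge of `M_{2ℓ+1}^{2k+1}(t)` spheres `S^{k+ℓ}` over `ℓ = 0,…,k`. -/
theorem matchingComplex_caterpillar (n : ℕ) (hn : 1 ≤ n) (m : Fin n → ℕ)
    (hm : ∀ i, 1 ≤ m i) :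
    (∀ k : ℕ, n = 2 * k →
      Nonempty
        (ContinuousMap.HomotopyEquiv
          (Realization (matchingComplex (caterpillar n m)))
          (WedgeOfSpheres
            (fun p : Σ ℓ : Fin (k + 1),
                Fin (Msum (2 * k) (2 * (ℓ : ℕ))
                  (fun i => if h : i - 1 < n then m ⟨i - 1, h⟩ - 1 else 0)) =>
              k - 1 + (p.1 : ℕ))))) ∧
    (∀ k : ℕ, n = 2 * k + 1 →
      Nonempty
        (ContinuousMap.HomotopyEquiv
          (Realization (matchingComplex (caterpillar n m)))
          (WedgeOfSpheres
            (fun p : Σ ℓ : Fin (k + 1),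
                Fin (Msum (2 * k + 1) (2 * (ℓ : ℕ) + 1)
                  (fun i => if h : i - 1 < n then m ⟨i - 1, h⟩ - 1 else 0)) =>
              k + (p.1 : ℕ))))) := by
  refine ⟨?_, ?_⟩
  · rintro k rfl
    exact nonempty_homotopyEquiv_matchingComplex_caterpillar hn hm
      (fun l : Fin (k + 1) => 2 * l.1) (fun l => k - 1 + l.1)
      (fun l l' h => Fin.ext (by simpa using h))
      (fun y p h => ⟨⟨y / 2, by omega⟩, by simp only; omega⟩)
      (fun l p h => by omega)
  · rintro k rfl
    exact nonempty_homotopyEquiv_matchingComplex_caterpillar hn hm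
      (fun l : Fin (k + 1) => 2 * l.1 + 1) (fun l => k + l.1)
      (fun l l' h => Fin.ext (by simpa using h))
      (fun y p h => ⟨⟨y / 2, by omega⟩, by simp only; omega⟩)
      (fun l p h => by omega)
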